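/- Let R be a commutative regular local ring. Then the following are equivalent: (i) every finitely generated projective module over the polynomial ring R[t] is free; (ii) every finitely generated projective module over the Laurent polynomial ring R[t,t⁻¹] is free; (iii) every finitely generated projective module over R⟨t⟩ is free; (iv) every finitely generated projective module over the formal Laurent series ring R((t)) is free. -/

import Mathlib

open Polynomial

/-- The multiplicative submonoid of monic polynomials in `R[t]`. -/
def monicSubmonoid (R : Type) [CommRing R] : Submonoid (Polynomial R) where
  carrier := {p | p.Monic}
  mul_mem' := fun ha hb => ha.mul hb
  one_mem' := monic_one

/-- `R⟨t⟩`: the localization of `R[t]` at the multiplicative set of monic polynomials. -/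
abbrev MonicLoc (R : Type) [CommRing R] :=
  Localization (monicSubmonoid R)

/-- All finitely generated projective modules over `A` are free. -/
def AllFGProjectiveFree (A : Type) [CommRing A] : Prop :=
  ∀ (P : Type) [AddCommGroup P] [Module A P]
    [Module.Finite A P] [Module.Projective A P], Module.Free A P


/-- Projective dimension at most `n` (in terms of finite free covers). -/
def PdLE (B : Type) [CommRing B] : ℕ → ∀ (M : Type) [AddCommGroup M] [Module B M], Prop
  | 0, M, _, _ => Module.Projective B M
  | n + 1, M, _, _ => ∀ (k : ℕ) (f : (Fin k → B) →ₗ[B] M), Function.Surjective f →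
      PdLE B n (LinearMap.ker f)

theorem PdLE.equiv {B : Type} [CommRing B] (n : ℕ) {M N : Type} [AddCommGroup M] [Module B M]
    [AddCommGroup N] [Module B N] (e : M ≃ₗ[B] N) (h : PdLE B n M) : PdLE B n N := by
  cases n with
  | zero =>
    have : Module.Projective B M := h
    exact Module.Projective.of_equiv e
  | succ n =>
    intro k f hf
    have := h k (e.symm.toLinearMap ∘ₗ f) (e.symm.surjective.comp hf)
    rwa [LinearEquiv.ker_comp] at this

open Pointwise in
theorem PdLE.of_quot {B : Type} [CommRing B] [IsLocalRing B] [IsNoetherianRing B]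
    (x : B) (hx : x ∈ IsLocalRing.maximalIdeal B) (hreg : IsSMulRegular B x) (n : ℕ) :
    ∀ (N : Type) [AddCommGroup N] [Module B N] [Module.Finite B N], IsSMulRegular N x →
      PdLE (B ⧸ Ideal.span {x}) n (QuotSMulTop x N) → PdLE B n N := by
  have hne : Nontrivial (B ⧸ Ideal.span {x}) := by
    rw [Ideal.Quotient.nontrivial_iff]
    intro h
    rw [Ideal.span_singleton_eq_top] at h
    exact (IsLocalRing.mem_maximalIdeal x).1 hx h
  have hloc : IsLocalRing (B ⧸ Ideal.span {x}) :=
    IsLocalRing.of_surjective' (Ideal.Quotient.mk _) Ideal.Quotient.mk_surjective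
  induction n with
  | zero =>
    intro N _ _ _ hN h
    have h1 : Module.Projective (B ⧸ Ideal.span {x}) (QuotSMulTop x N) := h
    have : Module.Finite (B ⧸ Ideal.span {x}) (QuotSMulTop x N) :=
      Module.Finite.of_restrictScalars_finite B _ _
    have h2 : Module.Free (B ⧸ Ideal.span {x}) (QuotSMulTop x N) :=
      Module.free_of_flat_of_isLocalRing
    have h3 : Module.Free B N := by
      have := Module.finitePresentation_of_finite B N
      refine (Module.free_quotSMulTop_iff_free B N (x := x) ?_ hN).1 h2
      rw [IsLocalRing.jacobson_eq_maximalIdeal _ bot_ne_top]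
      exact hx
    exact (inferInstance : Module.Projective B N)
  | succ n ih =>
    intro N _ _ _ hN h k f hf
    have hF : IsSMulRegular (Fin k → B) x := by
      intro a b hab
      funext i
      exact hreg (congrFun hab i)
    have hK : IsSMulRegular (LinearMap.ker f) x := by
      intro a b hab
      apply Subtype.ext
      exact hF (congrArg Subtype.val hab)
    refine ih _ hK ?_
    let fb : (Fin k → B ⧸ Ideal.span {x}) →ₗ[B ⧸ Ideal.span {x}] QuotSMulTop x N :=
      Fintype.linearCombination (B ⧸ Ideal.span {x})
        (fun i => (Submodule.mkQ (x • (⊤ : Submodule B N))) (f (Pi.single i 1)))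
    have hfb : ∀ v : Fin k → B, fb (fun i => Ideal.Quotient.mk _ (v i)) =
        (Submodule.mkQ (x • (⊤ : Submodule B N))) (f v) := by
      intro v
      have : v = ∑ i, v i • (Pi.single i (1 : B) : Fin k → B) := by
        rw [← pi_eq_sum_univ' v]
      conv_rhs => rw [this]
      rw [map_sum, map_sum, Fintype.linearCombination_apply]
      refine Finset.sum_congr rfl fun i _ => ?_
      rw [map_smul, map_smul]
      rfl
    have hlift : ∀ w : Fin k → B ⧸ Ideal.span {x}, ∃ v : Fin k → B,
        (fun i => Ideal.Quotient.mk _ (v i)) = w := by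
      intro w
      choose v hv using fun i => Ideal.Quotient.mk_surjective (w i)
      exact ⟨v, funext hv⟩
    have hfbs : Function.Surjective fb := by
      intro y
      obtain ⟨y, rfl⟩ := Submodule.mkQ_surjective _ y
      obtain ⟨v, rfl⟩ := hf y
      exact ⟨_, hfb v⟩
    refine PdLE.equiv n ?_ (h k fb hfbs)
    let g : LinearMap.ker f →ₗ[B] LinearMap.ker fb :=
      { toFun := fun v => ⟨fun i => Ideal.Quotient.mk _ (v.1 i), by
          rw [LinearMap.mem_ker, hfb, v.2, map_zero]⟩
        map_add' := fun v w => by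
          apply Subtype.ext; funext i; simp
        map_smul' := fun c v => by
          apply Subtype.ext; funext i
          simp only [SetLike.val_smul, Pi.smul_apply, smul_eq_mul, map_mul, RingHom.id_apply]
          rfl }
    have hgs : Function.Surjective g := by
      rintro ⟨w, hw⟩
      obtain ⟨v, rfl⟩ := hlift w
      rw [LinearMap.mem_ker, hfb, Submodule.mkQ_apply, Submodule.Quotient.mk_eq_zero,
        Submodule.mem_smul_pointwise_iff_exists] at hw
      obtain ⟨y, -, hy⟩ := hw
      obtain ⟨u, rfl⟩ := hf y
      refine ⟨⟨v - x • u, ?_⟩, ?_⟩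
      · rw [LinearMap.mem_ker, map_sub, map_smul, hy, sub_self]
      · apply Subtype.ext
        funext i
        change Ideal.Quotient.mk _ (v i - x * u i) = Ideal.Quotient.mk _ (v i)
        rw [Ideal.Quotient.mk_eq_mk_iff_sub_mem, Ideal.mem_span_singleton]
        exact ⟨- u i, by ring⟩
    have hgk : LinearMap.ker g = x • (⊤ : Submodule B (LinearMap.ker f)) := by
      ext v
      rw [LinearMap.mem_ker, Submodule.mem_smul_pointwise_iff_exists]
      constructor
      · intro hv
        have h1 : ∀ i, ∃ c, v.1 i = x * c := by
          intro i
          have := congrFun (congrArg Subtype.val hv) i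
          change Ideal.Quotient.mk _ (v.1 i) = 0 at this
          rwa [Ideal.Quotient.eq_zero_iff_mem, Ideal.mem_span_singleton] at this
        choose c hc using h1
        have hvc : v.1 = x • c := funext hc
        refine ⟨⟨c, ?_⟩, trivial, Subtype.ext hvc.symm⟩
        rw [LinearMap.mem_ker]
        apply hN
        change x • f c = x • 0
        rw [← map_smul, ← hvc, smul_zero]
        exact v.2
      · rintro ⟨u, -, rfl⟩
        apply Subtype.ext
        funext i
        change Ideal.Quotient.mk _ (x * u.1 i) = 0
        rw [Ideal.Quotient.eq_zero_iff_mem, Ideal.mem_span_singleton]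
        exact ⟨_, rfl⟩
    let e1 : QuotSMulTop x (LinearMap.ker f) ≃ₗ[B] LinearMap.ker fb :=
      (Submodule.quotEquivOfEq _ _ hgk.symm).trans (g.quotKerEquivOfSurjective hgs)
    exact (e1.extendScalarsOfSurjective Ideal.Quotient.mk_surjective).symm

theorem PdLE.all_succ {B : Type} [CommRing B] [IsLocalRing B] [IsNoetherianRing B]
    (x : B) (hx : x ∈ IsLocalRing.maximalIdeal B) (hreg : IsSMulRegular B x) (n : ℕ)
    (H : ∀ (N : Type) [AddCommGroup N] [Module (B ⧸ Ideal.span {x}) N]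
      [Module.Finite (B ⧸ Ideal.span {x}) N], PdLE (B ⧸ Ideal.span {x}) n N)
    (M : Type) [AddCommGroup M] [Module B M] [Module.Finite B M] : PdLE B (n + 1) M := by
  intro k f hf
  have hK : IsSMulRegular (LinearMap.ker f) x := by
    intro a b hab
    apply Subtype.ext
    funext i
    exact hreg (congrFun (congrArg Subtype.val hab) i)
  have : Module.Finite (B ⧸ Ideal.span {x}) (QuotSMulTop x (LinearMap.ker f)) :=
      Module.Finite.of_restrictScalars_finite B _ _
  exact PdLE.of_quot x hx hreg n _ hK (H _)


open IsLocalRing in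
theorem regular_aux (d : ℕ) : ∀ (R : Type) [CommRing R] [IsLocalRing R] [IsNoetherianRing R]
    (s : Finset R), s.card ≤ d → Ideal.span (s : Set R) = maximalIdeal R →
    ringKrullDim R = d → IsDomain R ∧ ∀ (M : Type) [AddCommGroup M] [Module R M]
      [Module.Finite R M], PdLE R d M := by
  classical
  induction d with
  | zero =>
    intro R _ _ _ s hs hm hd
    have hs0 : s = ∅ := by simpa using hs
    subst hs0
    have hb : maximalIdeal R = ⊥ := by rw [← hm]; simp
    have hf : IsField R := isField_iff_maximalIdeal_eq.2 hb
    refine ⟨hf.isDomain, ?_⟩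
    intro M _ _ _
    let := hf.toField
    exact (inferInstance : Module.Projective R M)
  | succ d ih =>
    intro R _ _ _ s hs hm hd
    have hht : ((maximalIdeal R).height : WithBot ℕ∞) = (d + 1 : ℕ) := by
      rw [maximalIdeal_height_eq_ringKrullDim, hd]
    have hht' : (maximalIdeal R).height = (d + 1 : ℕ) := by exact_mod_cast hht
    have hmin : ∀ p ∈ minimalPrimes R, ¬ maximalIdeal R ≤ p := by
      intro p hp hle
      have hpr : p.IsPrime := hp.1.1
      have h1 : maximalIdeal R = p := le_antisymm hle (le_maximalIdeal hpr.ne_top)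
      have h2 : p.height = 0 := Ideal.height_eq_zero_iff.2 hp
      rw [h1, h2] at hht'
      have h3 : (0 : ℕ) = d + 1 := by exact_mod_cast hht'
      omega
    have hjac : maximalIdeal R ≤ (⊥ : Ideal R).jacobson := maximalIdeal_le_jacobson _
    have hsq : ¬ maximalIdeal R ≤ (maximalIdeal R) ^ 2 := by
      intro hle
      have h0 : maximalIdeal R = ⊥ := by
        apply Submodule.eq_bot_of_le_smul_of_le_jacobson_bot (maximalIdeal R) _
          (maximalIdeal R).fg_of_isNoetherianRing _ hjac
        rw [smul_eq_mul, ← pow_two]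
        exact hle
      obtain ⟨p, hp, hpm⟩ := Ideal.exists_minimalPrimes_le
        (I := (⊥ : Ideal R)) (J := maximalIdeal R) bot_le
      exact hmin p hp (by rw [h0]; exact bot_le)
    obtain ⟨x, hxm, hx⟩ : ∃ x ∈ maximalIdeal R, x ∉ ((maximalIdeal R) ^ 2 : Ideal R) ∧
        ∀ p ∈ minimalPrimes R, x ∉ p := by
      by_contra! hcon
      have hfin := minimalPrimes.finite_of_isNoetherianRing R
      have := (Ideal.subset_union_prime' (R := R) (s := hfin.toFinset) (f := id)
        (a := (maximalIdeal R) ^ 2) (b := (maximalIdeal R) ^ 2) (I := maximalIdeal R)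
        (fun i hi => by
          have : i ∈ minimalPrimes R := by simpa using hi
          exact this.1.1)).1 (by
          intro x hx
          by_cases h2 : x ∈ (maximalIdeal R) ^ 2
          · left; left; exact h2
          · obtain ⟨p, hp, hxp⟩ := hcon x hx h2
            right
            simp only [Set.mem_iUnion]
            exact ⟨p, by simpa using hp, hxp⟩)
      rcases this with h | h | ⟨p, hp, h⟩
      · exact hsq h
      · exact hsq h
      · exact hmin p (by simpa using hp) h
    obtain ⟨hx2, hxp⟩ := hx
    have hxs : x ∈ Ideal.span (s : Set R) := by rw [hm]; exact hxm
    obtain ⟨c, hc⟩ := Submodule.mem_span_finset'.1 hxs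
    obtain ⟨y0, hy0⟩ : ∃ y : s, IsUnit (c y) := by
      by_contra! hcon
      apply hx2
      rw [← hc]
      refine Ideal.sum_mem _ fun y _ => ?_
      rw [pow_two, smul_eq_mul]
      exact Ideal.mul_mem_mul ((mem_maximalIdeal _).2 (hcon y))
        (by rw [← hm]; exact Ideal.subset_span y.2)
    let I : Ideal R := Ideal.span {x}
    have hIm : I ≤ maximalIdeal R := by
      rw [Ideal.span_singleton_le_iff_mem]; exact hxm
    have hne : Nontrivial (R ⧸ I) := by
      rw [Ideal.Quotient.nontrivial_iff]
      intro h
      rw [h] at hIm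
      exact (maximalIdeal.isMaximal R).ne_top (top_le_iff.1 hIm)
    have hloc : IsLocalRing (R ⧸ I) :=
      IsLocalRing.of_surjective' (Ideal.Quotient.mk _) Ideal.Quotient.mk_surjective
    have hmq : maximalIdeal (R ⧸ I) = (maximalIdeal R).map (Ideal.Quotient.mk I) := by
      symm
      apply IsLocalRing.eq_maximalIdeal
      have h1 := Ideal.map_eq_top_or_isMaximal_of_surjective (Ideal.Quotient.mk I)
        Ideal.Quotient.mk_surjective (maximalIdeal.isMaximal R)
      refine h1.resolve_left fun h => ?_
      have h2 := congrArg (Ideal.comap (Ideal.Quotient.mk I)) h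
      rw [Ideal.comap_map_of_surjective _ Ideal.Quotient.mk_surjective, Ideal.comap_top,
        ← RingHom.ker_eq_comap_bot, Ideal.mk_ker, sup_eq_left.2 hIm] at h2
      exact (maximalIdeal.isMaximal R).ne_top h2
    let s' : Finset (R ⧸ I) := (s.erase y0.1).image (Ideal.Quotient.mk I)
    have hs' : s'.card ≤ d := by
      refine Finset.card_image_le.trans ?_
      rw [Finset.card_erase_of_mem y0.2]
      omega
    have hspan : Ideal.span (s' : Set (R ⧸ I)) = maximalIdeal (R ⧸ I) := by
      rw [hmq]
      apply le_antisymm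
      · rw [Ideal.span_le]
        intro z hz
        simp only [s', Finset.coe_image] at hz
        obtain ⟨y, hy, rfl⟩ := hz
        apply Ideal.mem_map_of_mem
        rw [← hm]
        exact Ideal.subset_span (Finset.mem_of_mem_erase hy)
      · rw [← hm, Ideal.map_span, Ideal.span_le]
        rintro _ ⟨y, hy, rfl⟩
        have hmem : ∀ y ∈ s, y ≠ y0.1 → Ideal.Quotient.mk I y ∈ Ideal.span (s' : Set (R ⧸ I)) := by
          intro y hy hyy
          apply Ideal.subset_span
          simp only [s', Finset.coe_image]
          exact ⟨y, by simp [hy, hyy], rfl⟩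
        by_cases hyy : y = y0.1
        · subst hyy
          have h1 : Ideal.Quotient.mk I (∑ a : s, c a • a.1) = 0 := by
            rw [hc, Ideal.Quotient.eq_zero_iff_mem]
            exact Ideal.mem_span_singleton_self x
          rw [← Finset.add_sum_erase _ _ (Finset.mem_univ y0), map_add, smul_eq_mul, map_mul,
            map_sum] at h1
          have h2 : Ideal.Quotient.mk I (c y0) * Ideal.Quotient.mk I y0.1 ∈
              Ideal.span (s' : Set (R ⧸ I)) := by
            rw [eq_neg_of_add_eq_zero_left h1]
            refine neg_mem (Ideal.sum_mem _ fun a ha => ?_)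
            rw [smul_eq_mul, map_mul]
            refine Ideal.mul_mem_left _ _ (hmem _ a.2 ?_)
            intro h
            exact (Finset.ne_of_mem_erase ha) (Subtype.ext h)
          exact (Ideal.unit_mul_mem_iff_mem _ (hy0.map _)).1 h2
        · exact hmem y hy hyy
    have hdim1 : ringKrullDim (R ⧸ I) ≤ d := by
      refine (ringKrullDim_le_spanFinrank_maximalIdeal (R ⧸ I)).trans ?_
      rw [← hspan]
      have := Submodule.spanFinrank_span_le_ncard_of_finite (R := R ⧸ I) (s'.finite_toSet)
      rw [Set.ncard_coe_finset] at this
      exact_mod_cast this.trans hs'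
    have hdim2 : (d : WithBot ℕ∞) ≤ ringKrullDim (R ⧸ I) := by
      have h1 := Ideal.height_le_ringKrullDim_quotient_add_one (R := R) hxm
      rw [hht] at h1
      push_cast at h1
      exact (ENat.WithBot.add_le_add_one_right_iff).1 h1
    obtain ⟨hdom, hpd⟩ := ih (R ⧸ I) s' hs' hspan (le_antisymm hdim1 hdim2)
    have hIp : I.IsPrime := (Ideal.Quotient.isDomain_iff_prime I).1 hdom
    have hR : IsDomain R := by
      obtain ⟨p, hp, hpI⟩ := Ideal.exists_minimalPrimes_le
        (I := (⊥ : Ideal R)) (J := I) bot_le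
      have hpp : p.IsPrime := hp.1.1
      have hxp' := hxp p hp
      have h0 : p = ⊥ := by
        apply Submodule.eq_bot_of_le_smul_of_le_jacobson_bot I _
          p.fg_of_isNoetherianRing _ (hIm.trans hjac)
        intro z hz
        obtain ⟨w, rfl⟩ := Ideal.mem_span_singleton.1 (hpI hz)
        rw [smul_eq_mul]
        exact Ideal.mul_mem_mul (Ideal.mem_span_singleton_self x)
          ((hpp.mem_or_mem hz).resolve_left hxp')
      rw [h0] at hpp
      exact IsDomain.of_bot_isPrime R
    refine ⟨hR, ?_⟩
    have hx0 : x ≠ 0 := by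
      rintro rfl
      exact hx2 (zero_mem _)
    intro M _ _ _
    refine PdLE.all_succ x hxm ?_ d hpd M
    intro a b hab
    exact mul_left_cancel₀ hx0 hab

open IsLocalRing in
theorem regular_pdLE (R : Type) [CommRing R] [IsRegularLocalRing R] :
    ∃ d, ∀ (M : Type) [AddCommGroup M] [Module R M] [Module.Finite R M], PdLE R d M := by
  have h := (isRegularLocalRing_iff R).1 inferInstance
  obtain ⟨s, hs, hsp⟩ := Submodule.FG.exists_span_finset_card_eq_spanFinrank
    (maximalIdeal R).fg_of_isNoetherianRing
  exact ⟨_, (regular_aux _ R s hs.le hsp h.symm).2⟩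

open IsLocalRing in
theorem powerSeries_regular (R : Type) [CommRing R] [IsRegularLocalRing R] :
    IsRegularLocalRing (PowerSeries R) := by
  have h := (isRegularLocalRing_iff R).1 inferInstance
  apply IsRegularLocalRing.of_spanFinrank_maximalIdeal_le
  refine le_trans ?_ (ringKrullDim_succ_le_ringKrullDim_powerseries (R := R))
  have h1 := PowerSeries.spanFinrank_le_spanFinrank_map_constantCoeff_add_one_of_X_mem
    (R := R) (I := maximalIdeal (PowerSeries R)) (by
      rw [mem_maximalIdeal, mem_nonunits_iff, PowerSeries.isUnit_iff_constantCoeff]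
      simp)
  have h2 : (maximalIdeal (PowerSeries R)).map PowerSeries.constantCoeff = maximalIdeal R := by
    apply IsLocalRing.eq_maximalIdeal
    have hsurj : Function.Surjective (PowerSeries.constantCoeff (R := R)) := fun r =>
      ⟨PowerSeries.C r, by simp⟩
    refine (Ideal.map_eq_top_or_isMaximal_of_surjective _ hsurj
      (maximalIdeal.isMaximal _)).resolve_left fun h => ?_
    rw [Ideal.eq_top_iff_one, Ideal.mem_map_iff_of_surjective _ hsurj] at h
    obtain ⟨f, hf, hf1⟩ := h
    rw [mem_maximalIdeal, mem_nonunits_iff, PowerSeries.isUnit_iff_constantCoeff, hf1] at hf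
    exact hf isUnit_one
  rw [h2] at h1
  rw [← h]
  exact_mod_cast h1


/-- Stably free (of finite type). -/
def SF (L : Type) [CommRing L] (P : Type) [AddCommGroup P] [Module L P] : Prop :=
  ∃ m n : ℕ, Nonempty ((P × (Fin m → L)) ≃ₗ[L] (Fin n → L))

theorem SF_of_PdLE {B L : Type} [CommRing B] [IsLocalRing B] [IsNoetherianRing B] [CommRing L]
    [Nontrivial L] [Algebra B L] (S : Submonoid B) [IsLocalization S L] (n : ℕ) :
    ∀ (M P : Type) [AddCommGroup M] [Module B M] [Module.Finite B M] [AddCommGroup P]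
      [Module B P] [Module L P] [IsScalarTower B L P] [Module.Projective L P]
      (φ : M →ₗ[B] P) (_ : ∀ p : P, ∃ s : S, ∃ m : M, s • p = φ m)
      (_ : ∀ m : M, φ m = 0 → ∃ s : S, s • m = 0), PdLE B n M → SF L P := by
  induction n with
  | zero =>
    intro M P _ _ _ _ _ _ _ _ φ h1 h2 h
    have : Module.Projective B M := h
    have hfree : Module.Free B M := Module.free_of_flat_of_isLocalRing
    have hu : ∀ s : S, IsUnit (algebraMap B L s) := fun s => IsLocalization.map_units L s
    have hloc : IsLocalizedModule S φ := by
      refine ⟨fun s => ?_, fun p => ?_, fun {a b} hab => ?_⟩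
      · have hs : IsUnit (algebraMap L (Module.End L P) (algebraMap B L s)) := (hu s).map _
        rw [Module.End.isUnit_iff] at hs ⊢
        convert hs using 1
        funext p
        simp [algebraMap_smul]
      · obtain ⟨s, m, hm⟩ := h1 p
        exact ⟨(m, s), hm⟩
      · obtain ⟨s, hs⟩ := h2 (a - b) (by rw [map_sub, hab, sub_self])
        exact ⟨s, by rw [← sub_eq_zero, ← smul_sub, hs]⟩
    have hPf : Module.Free L P := Module.free_of_isLocalizedModule S φ
    have hfin : Module.Finite L P := Module.Finite.of_isLocalizedModule S φ
    let b := Module.finBasis L P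
    exact ⟨0, _, ⟨(LinearEquiv.prodUnique).trans b.equivFun⟩⟩
  | succ n ih =>
    intro M P _ _ _ _ _ _ _ _ φ h1 h2 h
    have hu : ∀ s : S, IsUnit (algebraMap B L s) := fun s => IsLocalization.map_units L s
    obtain ⟨k, f, hf⟩ := Module.Finite.exists_fin' B M
    have hK := h k f hf
    let ι : (Fin k → B) →ₗ[B] (Fin k → L) :=
      { toFun := fun v i => algebraMap B L (v i)
        map_add' := fun v w => by funext i; simp
        map_smul' := fun c v => by funext i; simp [Algebra.smul_def] }
    let F : (Fin k → L) →ₗ[L] P := Fintype.linearCombination L (fun i => φ (f (Pi.single i 1)))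
    have hF : ∀ v, F (ι v) = φ (f v) := by
      intro v
      have : v = ∑ i, v i • (Pi.single i (1 : B) : Fin k → B) := by
        rw [← pi_eq_sum_univ' v]
      conv_rhs => rw [this]
      rw [map_sum, map_sum, Fintype.linearCombination_apply]
      refine Finset.sum_congr rfl fun i _ => ?_
      rw [map_smul, map_smul]
      simp [ι, algebraMap_smul]
    have hFs : Function.Surjective F := by
      intro p
      obtain ⟨s, m, hm⟩ := h1 p
      obtain ⟨v, rfl⟩ := hf m
      obtain ⟨u, hu⟩ := hu s
      refine ⟨(↑u⁻¹ : L) • ι v, ?_⟩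
      rw [map_smul, hF, ← hm, Submonoid.smul_def, ← algebraMap_smul L (s : B) p, ← hu, smul_smul]
      simp
    obtain ⟨σ, hσ⟩ := Module.projective_lifting_property F LinearMap.id hFs
    have hker : (P × LinearMap.ker F) ≃ₗ[L] (Fin k → L) := by
      have hσ' : ∀ p, F (σ p) = p := fun p => LinearMap.congr_fun hσ p
      exact
      { toFun := fun x => σ x.1 + x.2.1
        map_add' := fun x y => by simp; abel
        map_smul' := fun c x => by simp
        invFun := fun v => (F v, ⟨v - σ (F v), by simp [hσ']⟩)
        left_inv := fun x => by
          have : F x.2.1 = 0 := x.2.2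
          ext1
          · simp [hσ', this]
          · apply Subtype.ext; simp [hσ', this]
        right_inv := fun v => by simp }
    have hpK : Module.Projective L (LinearMap.ker F) :=
      Module.Projective.of_split (hker.toLinearMap ∘ₗ LinearMap.inr L P _)
        (LinearMap.snd L P _ ∘ₗ hker.symm.toLinearMap) (by ext x; simp)
    let φ' : LinearMap.ker f →ₗ[B] LinearMap.ker F :=
      { toFun := fun v => ⟨ι v.1, by rw [LinearMap.mem_ker, hF, v.2, map_zero]⟩
        map_add' := fun v w => by apply Subtype.ext; simp
        map_smul' := fun c v => by apply Subtype.ext; simp }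
    obtain ⟨m, l, ⟨e⟩⟩ := ih (LinearMap.ker f) (LinearMap.ker F) φ' (by
      rintro ⟨w, hw⟩
      obtain ⟨s, hs⟩ := IsLocalization.exist_integer_multiples_of_finite S w
      choose v hv using hs
      have hv' : ι v = s • w := by
        funext i
        exact hv i
      have h3 : φ (f v) = 0 := by
        rw [← hF, hv', Submonoid.smul_def, LinearMap.map_smul_of_tower, hw, smul_zero]
      obtain ⟨s', hs'⟩ := h2 _ h3
      refine ⟨s' * s, ⟨(s' : B) • v, ?_⟩, ?_⟩
      · rw [LinearMap.mem_ker, map_smul]; exact hs'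
      · apply Subtype.ext
        change (s' * s) • w = ι ((s' : B) • v)
        rw [map_smul, hv', mul_smul]
        rfl) (by
      rintro ⟨v, hv⟩ h0
      have h3 : ι v = 0 := congrArg Subtype.val h0
      have h4 : ∀ i, ∃ s : S, s • v i = 0 := by
        intro i
        have := congrFun h3 i
        obtain ⟨s, hs⟩ := (IsLocalization.map_eq_zero_iff S L (v i)).1 this
        exact ⟨s, hs⟩
      choose s hs using h4
      refine ⟨∏ i, s i, Subtype.ext ?_⟩
      funext i
      change (∏ i, s i) • v i = 0
      rw [← Finset.prod_erase_mul _ _ (Finset.mem_univ i), mul_smul, hs, smul_zero]) hK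
    refine ⟨l, k + m, ⟨?_⟩⟩
    let e1 : (P × (Fin l → L)) ≃ₗ[L] (P × (LinearMap.ker F × (Fin m → L))) :=
      (LinearEquiv.refl L P).prodCongr e.symm
    let e2 : (P × (LinearMap.ker F × (Fin m → L))) ≃ₗ[L] ((Fin k → L) × (Fin m → L)) :=
      (LinearEquiv.prodAssoc L P _ _).symm.trans (hker.prodCongr (LinearEquiv.refl L _))
    exact (e1.trans e2).trans ((LinearEquiv.sumArrowLequivProdArrow _ _ L L).symm.trans
      (LinearEquiv.funCongrLeft L L finSumFinEquiv.symm))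

theorem laurent_SF (R : Type) [CommRing R] [IsRegularLocalRing R] (P : Type) [AddCommGroup P]
    [Module (LaurentSeries R) P] [Module.Finite (LaurentSeries R) P]
    [Module.Projective (LaurentSeries R) P] : SF (LaurentSeries R) P := by
  have hreg := powerSeries_regular R
  obtain ⟨d, hd⟩ := regular_pdLE (PowerSeries R)
  let : Module (PowerSeries R) P :=
    Module.compHom P (algebraMap (PowerSeries R) (LaurentSeries R))
  have : IsScalarTower (PowerSeries R) (LaurentSeries R) P :=
    ⟨fun a b p => by
      rw [Algebra.smul_def, mul_smul]; rfl⟩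
  obtain ⟨k, f, hf⟩ := Module.Finite.exists_fin' (LaurentSeries R) P
  let M : Submodule (PowerSeries R) P :=
    Submodule.span (PowerSeries R) (Set.range fun i => f (Pi.single i 1))
  have hM : Module.Finite (PowerSeries R) M := Module.Finite.span_of_finite _ (Set.finite_range _)
  refine SF_of_PdLE (Submonoid.powers (PowerSeries.X : PowerSeries R)) d M P M.subtype ?_ ?_ (hd M)
  · intro p
    obtain ⟨w, rfl⟩ := hf p
    obtain ⟨s, hs⟩ := IsLocalization.exist_integer_multiples_of_finite
      (Submonoid.powers (PowerSeries.X : PowerSeries R)) w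
    choose v hv using hs
    refine ⟨s, ⟨s • f w, ?_⟩, rfl⟩
    have h1 : w = ∑ i, w i • (Pi.single i (1 : LaurentSeries R) : Fin k → LaurentSeries R) := by
      rw [← pi_eq_sum_univ' w]
    rw [h1, map_sum, Finset.smul_sum]
    refine Submodule.sum_mem _ fun i _ => ?_
    rw [map_smul, Submonoid.smul_def, ← smul_assoc]
    have h2 : (s : PowerSeries R) • w i = algebraMap _ _ (v i) := (hv i).symm
    rw [h2, algebraMap_smul]
    exact Submodule.smul_mem _ _ (Submodule.subset_span ⟨i, rfl⟩)
  · intro m hm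
    refine ⟨1, ?_⟩
    rw [one_smul]
    exact Subtype.ext hm


/-- A row is completable if it can be moved to the first unit vector by an invertible matrix. -/
def CplRow {B : Type} [CommRing B] {n : ℕ} (v : Fin (n + 1) → B) : Prop :=
  ∃ g h : Matrix (Fin (n + 1)) (Fin (n + 1)) B, g * h = 1 ∧
    Matrix.vecMul v g = Pi.single 0 1

theorem CplRow.map {B C : Type} [CommRing B] [CommRing C] (f : B →+* C) {n : ℕ}
    {v : Fin (n + 1) → B} (h : CplRow v) : CplRow (fun i => f (v i)) := by
  obtain ⟨g, h, hgh, hv⟩ := h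
  refine ⟨g.map f, h.map f, ?_, ?_⟩
  · rw [← Matrix.map_mul, hgh, Matrix.map_one f (map_zero f) (map_one f)]
  · funext i
    have := RingHom.map_vecMul f g v i
    rw [hv] at this
    change Matrix.vecMul (f ∘ v) (g.map f) i = _
    rw [← this]
    by_cases hi : i = 0
    · subst hi; simp
    · simp [hi]

theorem CplRow.of_mul {B : Type} [CommRing B] {n : ℕ}
    {v w : Fin (n + 1) → B} (k l : Matrix (Fin (n + 1)) (Fin (n + 1)) B) (hkl : k * l = 1)
    (hw : Matrix.vecMul v k = w) (h : CplRow w) : CplRow v := by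
  obtain ⟨g, h, hgh, hv⟩ := h
  refine ⟨k * g, h * l, ?_, ?_⟩
  · rw [Matrix.mul_assoc, ← Matrix.mul_assoc g, hgh, Matrix.one_mul, hkl]
  · rw [← Matrix.vecMul_vecMul, hw, hv]

theorem CplRow.of_allFree {B : Type} [CommRing B] [Nontrivial B] (H : AllFGProjectiveFree B) {n : ℕ}
    (v w : Fin (n + 1) → B) (hvw : v ⬝ᵥ w = 1) : CplRow v := by
  let φ : (Fin (n + 1) → B) →ₗ[B] B :=
    { toFun := fun x => v ⬝ᵥ x
      map_add' := fun x y => dotProduct_add v x y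
      map_smul' := fun c x => dotProduct_smul c v x }
  have hφw : φ w = 1 := hvw
  let E : (Fin (n + 1) → B) ≃ₗ[B] (B × LinearMap.ker φ) :=
    { toFun := fun x => (φ x, ⟨x - φ x • w, by simp [hφw]⟩)
      map_add' := fun x y => by
        ext1
        · simp
        · apply Subtype.ext; simp [add_smul]; abel
      map_smul' := fun c x => by
        ext1
        · simp
        · apply Subtype.ext; simp [mul_smul, smul_sub]
      invFun := fun y => y.1 • w + y.2.1
      left_inv := fun x => by simp
      right_inv := fun y => by
        have : φ y.2.1 = 0 := y.2.2
        ext1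
        · simp [hφw, this]
        · apply Subtype.ext; simp [hφw, this] }
  have hp : Module.Projective B (LinearMap.ker φ) :=
    Module.Projective.of_split (E.symm.toLinearMap ∘ₗ LinearMap.inr B B _)
      (LinearMap.snd B B _ ∘ₗ E.toLinearMap) (by
        apply LinearMap.ext; intro x
        change (E (E.symm (0, x))).2 = x
        rw [E.apply_symm_apply])
  have hfin : Module.Finite B (LinearMap.ker φ) :=
    Module.Finite.of_surjective (LinearMap.snd B B _ ∘ₗ E.toLinearMap)
      (Prod.snd_surjective.comp E.surjective)
  have hfree : Module.Free B (LinearMap.ker φ) := H _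
  have hrank : Module.finrank B (LinearMap.ker φ) = n := by
    have := E.finrank_eq
    rw [Module.finrank_prod, Module.finrank_self, Module.finrank_fin_fun] at this
    omega
  let b := (Module.finBasisOfFinrankEq B (LinearMap.ker φ) hrank).equivFun
  let Θ : (Fin (n + 1) → B) ≃ₗ[B] (Fin (n + 1) → B) :=
    (E.trans ((LinearEquiv.refl B B).prodCongr b)).trans
      (Fin.consLinearEquiv B (fun _ : Fin (n + 1) => B))
  have hΘ : ∀ x, Θ x 0 = v ⬝ᵥ x := fun x => rfl
  refine ⟨LinearMap.toMatrix' Θ.symm.toLinearMap, LinearMap.toMatrix' Θ.toLinearMap, ?_, ?_⟩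
  · rw [← LinearMap.toMatrix'_comp, LinearEquiv.symm_comp, LinearMap.toMatrix'_id]
  · funext j
    have h1 : Matrix.vecMul v (LinearMap.toMatrix' Θ.symm.toLinearMap) j =
        v ⬝ᵥ (Θ.symm (Pi.single j 1)) := by
      rw [Matrix.vecMul]
      congr 1
    rw [h1, ← hΘ, LinearEquiv.apply_symm_apply]
    by_cases hj : j = 0
    · subst hj; simp
    · rw [Pi.single_eq_of_ne hj, Pi.single_eq_of_ne (Ne.symm hj)]

theorem free_of_compl {B : Type} [CommRing B] [Nontrivial B]
    (H : ∀ (n : ℕ) (v w : Fin (n + 1) → B), v ⬝ᵥ w = 1 → CplRow v) (m : ℕ) :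
    ∀ (P : Type) [AddCommGroup P] [Module B P] (n : ℕ) (_ : (P × (Fin m → B)) ≃ₗ[B] (Fin n → B)),
      Module.Free B P := by
  induction m with
  | zero =>
    intro P _ _ n e
    exact Module.Free.of_equiv (e.symm.trans LinearEquiv.prodUnique)
  | succ m ih =>
    intro P _ _ n e
    have e1 : ((P × B) × (Fin m → B)) ≃ₗ[B] (Fin n → B) :=
      ((LinearEquiv.prodAssoc B P B (Fin m → B)).trans ((LinearEquiv.refl B P).prodCongr
        (Fin.consLinearEquiv B (fun _ : Fin (m + 1) => B)))).trans e
    have hfree := ih (P × B) n e1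
    have hfin : Module.Finite B (P × B) :=
      Module.Finite.of_surjective (LinearMap.fst B _ _ ∘ₗ e1.symm.toLinearMap)
        (Prod.fst_surjective.comp e1.symm.surjective)
    have e2 := (Module.finBasis B (P × B)).equivFun
    generalize hk : Module.finrank B (P × B) = k at e2
    cases k with
    | zero =>
      exfalso
      have h1 : ((0 : P), (1 : B)) = 0 := e2.injective (Subsingleton.elim _ _)
      exact one_ne_zero (congrArg Prod.snd h1)
    | succ k =>
      let φ : (Fin (k + 1) → B) →ₗ[B] B := LinearMap.snd B P B ∘ₗ e2.symm.toLinearMap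
      let v : Fin (k + 1) → B := fun i => φ (Pi.single i 1)
      have hφ : ∀ x, φ x = v ⬝ᵥ x := by
        intro x
        have : x = ∑ i, x i • (Pi.single i (1 : B) : Fin (k + 1) → B) := by
          rw [← pi_eq_sum_univ' x]
        conv_lhs => rw [this]
        rw [map_sum, dotProduct]
        refine Finset.sum_congr rfl fun i _ => ?_
        rw [map_smul, smul_eq_mul, mul_comm]
      obtain ⟨g, h, hgh, hv⟩ := H k v (e2 (0, 1)) (by
        rw [← hφ]; simp [φ])
      have hhg : h * g = 1 := mul_eq_one_comm.1 hgh
      have hφg : ∀ x, φ (g.mulVec x) = x 0 := by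
        intro x
        rw [hφ, Matrix.dotProduct_mulVec, hv]
        simp
      let ψ : P →ₗ[B] (Fin k → B) :=
        { toFun := fun p => Fin.tail (h.mulVec (e2 (p, 0)))
          map_add' := fun p q => by
            have : ((p + q, 0) : P × B) = (p, 0) + (q, 0) := by simp
            rw [this, map_add, Matrix.mulVec_add]; rfl
          map_smul' := fun c p => by
            have : ((c • p, 0) : P × B) = c • (p, 0) := by simp
            rw [this, map_smul, Matrix.mulVec_smul]; rfl }
      have h0 : ∀ p, (h.mulVec (e2 (p, 0))) 0 = 0 := by
        intro p
        rw [← hφg (h.mulVec _), Matrix.mulVec_mulVec, hgh, Matrix.one_mulVec]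
        simp [φ]
      have hψ : Function.Bijective ψ := by
        constructor
        · rw [← LinearMap.ker_eq_bot, LinearMap.ker_eq_bot']
          intro p hp
          have h1 : h.mulVec (e2 (p, 0)) = 0 := by
            funext i
            refine Fin.cases (h0 p) (fun j => ?_) i
            exact congrFun hp j
          have h2 := congrArg g.mulVec h1
          rw [Matrix.mulVec_mulVec, hgh, Matrix.one_mulVec, Matrix.mulVec_zero] at h2
          have h3 := e2.map_eq_zero_iff.1 h2
          exact congrArg Prod.fst h3
        · intro y
          let z : Fin (k + 1) → B := Fin.cons 0 y
          have hz : (e2.symm (g.mulVec z)).2 = 0 := by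
            have := hφg z
            simpa [z, φ] using this
          refine ⟨(e2.symm (g.mulVec z)).1, ?_⟩
          change Fin.tail (h.mulVec (e2 ((e2.symm (g.mulVec z)).1, 0))) = y
          rw [← hz, Prod.mk.eta, LinearEquiv.apply_symm_apply, Matrix.mulVec_mulVec, hhg,
            Matrix.one_mulVec]
          simp [z]
      exact Module.Free.of_equiv (LinearEquiv.ofBijective ψ hψ).symm


theorem monic_nakayama {R : Type} [CommRing R] [IsLocalRing R] (T : Ideal R[X]) (f : R[X])
    (hf : f.Monic) (hfT : f ∈ T)
    (h : T ⊔ (IsLocalRing.maximalIdeal R).map (C : R →+* R[X]) = ⊤) : T = ⊤ := by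
  have hfin1 : Module.Finite R (R[X] ⧸ Ideal.span {f}) := hf.finite_adjoinRoot
  have hle : Ideal.span {f} ≤ T := by rwa [Ideal.span_singleton_le_iff_mem]
  have hfin : Module.Finite R (R[X] ⧸ T) :=
    Module.Finite.of_surjective (Ideal.Quotient.factorₐ R hle).toLinearMap
      (Ideal.Quotient.factor_surjective hle)
  have htop : (⊤ : Submodule R (R[X] ⧸ T)) ≤ IsLocalRing.maximalIdeal R • ⊤ := by
    intro y _
    obtain ⟨p, rfl⟩ := Ideal.Quotient.mk_surjective y
    have hp : p ∈ T ⊔ (IsLocalRing.maximalIdeal R).map (C : R →+* R[X]) := by rw [h]; trivial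
    obtain ⟨t, ht, q, hq, rfl⟩ := Submodule.mem_sup.1 hp
    rw [map_add, Ideal.Quotient.eq_zero_iff_mem.2 ht, zero_add]
    have h1 : q ∈ Submodule.restrictScalars R
      ((IsLocalRing.maximalIdeal R).map (algebraMap R R[X])) := hq
    rw [← Ideal.smul_top_eq_map] at h1
    have h2 := Submodule.mem_map_of_mem (f := (Ideal.Quotient.mkₐ R T).toLinearMap) h1
    rw [Submodule.map_smul''] at h2
    exact Submodule.smul_mono le_rfl le_top h2
  have hbot := Submodule.eq_bot_of_le_smul_of_le_jacobson_bot (IsLocalRing.maximalIdeal R)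
    (⊤ : Submodule R (R[X] ⧸ T)) hfin.fg_top htop (IsLocalRing.maximalIdeal_le_jacobson _)
  rw [Ideal.eq_top_iff_one, ← Ideal.Quotient.eq_zero_iff_mem]
  have : (1 : R[X] ⧸ T) ∈ (⊤ : Submodule R (R[X] ⧸ T)) := trivial
  rw [hbot] at this
  exact this

theorem coe_dvd_iff {R : Type} [CommRing R] (n : ℕ) (p : R[X]) :
    (PowerSeries.X : PowerSeries R) ^ n ∣ (p : PowerSeries R) ↔ X ^ n ∣ p := by
  rw [PowerSeries.X_pow_dvd_iff, Polynomial.X_pow_dvd_iff]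
  simp

theorem trunc_dvd {R : Type} [CommRing R] (n : ℕ) (α : PowerSeries R) :
    (PowerSeries.X : PowerSeries R) ^ n ∣ ((PowerSeries.trunc n α : R[X]) : PowerSeries R) - α := by
  rw [PowerSeries.X_pow_dvd_iff]
  intro m hm
  simp [PowerSeries.coeff_trunc, hm]

theorem move_row {R : Type} [CommRing R] [IsLocalRing R] {n : ℕ} (N : ℕ)
    (α β : Fin (n + 2) → PowerSeries R) (hαβ : α ⬝ᵥ β = PowerSeries.X ^ N) :
    ∃ a w : Fin (n + 2) → R[X],
      (∀ i, (PowerSeries.X : PowerSeries R) ^ (N + 1) ∣ (a i : PowerSeries R) - α i) ∧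
      (a 0).Monic ∧ a ⬝ᵥ w = X ^ N := by
  let a0 : R[X] := X ^ (N + 1) + PowerSeries.trunc (N + 1) (α 0)
  have ha0 : a0.Monic := monic_X_pow_add (PowerSeries.degree_trunc_lt _ _)
  let ρ := IsLocalRing.residue R
  have hρ : Function.Surjective (Polynomial.mapRingHom ρ) :=
    Polynomial.map_surjective _ IsLocalRing.residue_surjective
  have hne : a0.map ρ ≠ 0 := (ha0.map ρ).ne_zero
  obtain ⟨u, hu, hnd⟩ := Polynomial.exists_eq_pow_rootMultiplicity_mul_and_not_dvd _ hne 0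
  generalize rootMultiplicity 0 (a0.map ρ) = e at hu
  rw [C_0, sub_zero] at hu hnd
  have hcop : IsCoprime ((X : (IsLocalRing.ResidueField R)[X]) ^ (N + 1)) u :=
    IsCoprime.pow_left ((irreducible_X.coprime_iff_not_dvd).2 hnd)
  obtain ⟨p, q, hpq⟩ := hcop
  let a1' : R[X] := PowerSeries.trunc (N + 1) (α 1)
  obtain ⟨c, hc⟩ := hρ (p * (1 - a1'.map ρ))
  let a1 : R[X] := a1' + X ^ (N + 1) * c
  have hc' : c.map ρ = p * (1 - a1'.map ρ) := hc
  have ha1 : a1.map ρ = 1 - q * u * (1 - a1'.map ρ) := by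
    simp only [a1, Polynomial.map_add, Polynomial.map_mul, Polynomial.map_pow, map_X, hc']
    linear_combination (1 - a1'.map ρ) * hpq
  let a : Fin (n + 2) → R[X] := fun i =>
    if i = 0 then a0 else if i = 1 then a1 else PowerSeries.trunc (N + 1) (α i)
  have ha_0 : a 0 = a0 := by simp [a]
  have ha_1 : a 1 = a1 := by simp [a]
  have hdvd : ∀ i, (PowerSeries.X : PowerSeries R) ^ (N + 1) ∣ (a i : PowerSeries R) - α i := by
    intro i
    by_cases h0 : i = 0
    · subst h0
      rw [ha_0]
      simp only [a0, Polynomial.coe_add, Polynomial.coe_pow, Polynomial.coe_X]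
      rw [add_sub_assoc]
      exact dvd_add dvd_rfl (trunc_dvd _ _)
    · by_cases h1 : i = 1
      · subst h1
        rw [ha_1]
        simp only [a1, a1', Polynomial.coe_add, Polynomial.coe_mul, Polynomial.coe_pow,
          Polynomial.coe_X]
        rw [add_sub_right_comm]
        exact dvd_add (trunc_dvd _ _) (dvd_mul_right _ _)
      · simp only [a, h0, h1, if_false]
        exact trunc_dvd _ _
  let b : Fin (n + 2) → R[X] := fun i => PowerSeries.trunc (N + 1) (β i)
  have hab : X ^ (N + 1) ∣ a ⬝ᵥ b - X ^ N := by
    rw [← coe_dvd_iff]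
    have h1 : ((a ⬝ᵥ b - X ^ N : R[X]) : PowerSeries R) =
        ∑ i, (((a i : PowerSeries R) - α i) * (b i : PowerSeries R) +
          α i * ((b i : PowerSeries R) - β i)) := by
      have h2 : ((a ⬝ᵥ b : R[X]) : PowerSeries R) = ∑ i, (a i : PowerSeries R) * b i := by
        rw [dotProduct, ← Polynomial.coeToPowerSeries.ringHom_apply, map_sum]
        simp
      rw [Polynomial.coe_sub, Polynomial.coe_pow, Polynomial.coe_X, ← hαβ, h2, dotProduct,
        ← Finset.sum_sub_distrib]
      refine Finset.sum_congr rfl fun i _ => by ring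
    rw [h1]
    refine Finset.dvd_sum fun i _ => dvd_add (Dvd.dvd.mul_right (hdvd i) _)
      (Dvd.dvd.mul_left (trunc_dvd _ _) _)
  obtain ⟨g, hg⟩ := hab
  let I : Ideal R[X] := Ideal.span (Set.range a)
  have haI : ∀ i, a i ∈ I := fun i => Ideal.subset_span ⟨i, rfl⟩
  have hT : I ⊔ Ideal.span {1 + X * g} = ⊤ := by
    apply monic_nakayama _ a0 ha0 (Ideal.mem_sup_left (ha_0 ▸ haI 0))
    rw [Ideal.eq_top_iff_one]
    obtain ⟨q', hq'⟩ := hρ q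
    have hq'' : q'.map ρ = q := hq'
    have hk : X ^ e - (X ^ e * a1 + a0 * (q' * (1 - a1'))) ∈
        (IsLocalRing.maximalIdeal R).map (C : R →+* R[X]) := by
      have hker : RingHom.ker (Polynomial.mapRingHom ρ) =
          (IsLocalRing.maximalIdeal R).map (C : R →+* R[X]) := by
        rw [Polynomial.ker_mapRingHom, IsLocalRing.ker_residue]
      rw [← hker, RingHom.mem_ker]
      simp only [coe_mapRingHom, Polynomial.map_sub, Polynomial.map_add, Polynomial.map_mul,
        Polynomial.map_pow, map_X, ha1, hu, hq'', Polynomial.map_one]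
      ring
    have hcop : IsCoprime (1 + X * g) (X ^ e : R[X]) := by
      apply IsCoprime.pow_right
      exact ⟨1, -g, by ring⟩
    obtain ⟨r, s, hrs⟩ := hcop
    suffices hh : r * (1 + X * g) + s * X ^ e ∈ I ⊔ Ideal.span {1 + X * g} ⊔
        (IsLocalRing.maximalIdeal R).map (C : R →+* R[X]) by rwa [hrs] at hh
    refine add_mem (Ideal.mem_sup_left (Ideal.mem_sup_right
      (Ideal.mul_mem_left _ _ (Ideal.mem_span_singleton_self _)))) ?_
    apply Ideal.mul_mem_left
    rw [← sub_add_cancel (X ^ e : R[X]) (X ^ e * a1 + a0 * (q' * (1 - a1')))]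
    refine add_mem (Ideal.mem_sup_right hk) (Ideal.mem_sup_left (Ideal.mem_sup_left ?_))
    exact add_mem (Ideal.mul_mem_left _ _ (ha_1 ▸ haI 1))
      (Ideal.mul_mem_right _ _ (ha_0 ▸ haI 0))
  have hXN : X ^ N ∈ I := by
    have h1 : (1 : R[X]) ∈ I ⊔ Ideal.span {1 + X * g} := by rw [hT]; trivial
    obtain ⟨i, hi, y, hy, hiy⟩ := Submodule.mem_sup.1 h1
    obtain ⟨z, rfl⟩ := Ideal.mem_span_singleton'.1 hy
    have h2 : (X : R[X]) ^ N = X ^ N * i + z * (a ⬝ᵥ b) := by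
      linear_combination (- (X : R[X]) ^ N) * hiy - z * hg
    rw [h2]
    refine add_mem (Ideal.mul_mem_left _ _ hi) (Ideal.mul_mem_left _ _ ?_)
    exact Ideal.sum_mem _ fun i _ => Ideal.mul_mem_right _ _ (haI i)
  obtain ⟨w, hw⟩ := (Submodule.mem_span_range_iff_exists_fun R[X]).1 hXN
  refine ⟨a, w, hdvd, ha_0 ▸ ha0, ?_⟩
  rw [← hw, dotProduct]
  exact Finset.sum_congr rfl fun i _ => by rw [smul_eq_mul, mul_comm]


theorem CplRow.of_diag {B : Type} [CommRing B] {n : ℕ} {v w : Fin (n + 1) → B}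
    (d e : Fin (n + 1) → B) (hde : ∀ i, d i * e i = 1) (hw : ∀ i, v i * d i = w i)
    (h : CplRow w) : CplRow v := by
  refine CplRow.of_mul (Matrix.diagonal d) (Matrix.diagonal e) ?_ ?_ h
  · rw [Matrix.diagonal_mul_diagonal]
    simp [hde]
  · funext i
    rw [Matrix.vecMul_diagonal, hw]

theorem CplRow.of_congr {R : Type} [CommRing R] {n : ℕ} (N : ℕ)
    (α β : Fin (n + 1) → PowerSeries R) (hαβ : α ⬝ᵥ β = PowerSeries.X ^ N)
    (a : Fin (n + 1) → PowerSeries R)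
    (ha : ∀ i, (PowerSeries.X : PowerSeries R) ^ (N + 1) ∣ a i - α i)
    {B : Type} [CommRing B] (f : PowerSeries R →+* B) (h : CplRow (fun i => f (a i))) :
    CplRow (fun i => f (α i)) := by
  choose γ hγ using ha
  let M : Matrix (Fin (n + 1)) (Fin (n + 1)) (PowerSeries R) :=
    1 + (PowerSeries.X : PowerSeries R) • Matrix.vecMulVec β γ
  have hdet : IsUnit M.det := by
    rw [PowerSeries.isUnit_iff_constantCoeff, RingHom.map_det]
    have : (PowerSeries.constantCoeff (R := R)).mapMatrix M = 1 := by
      ext i j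
      simp [M, Matrix.one_apply]
    rw [this, Matrix.det_one]
    exact isUnit_one
  have hM : M * M⁻¹ = 1 := Matrix.mul_nonsing_inv M hdet
  refine CplRow.of_mul (M.map f) (M⁻¹.map f) ?_ ?_ h
  · rw [← Matrix.map_mul, hM, Matrix.map_one f (map_zero f) (map_one f)]
  · funext j
    have h1 := RingHom.map_vecMul f M α j
    change Matrix.vecMul (f ∘ α) (M.map f) j = _
    rw [← h1]
    congr 1
    simp only [M, Matrix.vecMul_add, Matrix.vecMul_one, Matrix.vecMul_smul,
      Matrix.vecMul_vecMulVec, hαβ, Pi.add_apply, Pi.smul_apply, smul_eq_mul]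
    have := hγ j
    rw [pow_succ] at this
    linear_combination -this

/-- The unit `X` in the ring of Laurent series. -/
noncomputable def lX (R : Type) [CommRing R] : (LaurentSeries R)ˣ where
  val := HahnSeries.single 1 1
  inv := HahnSeries.single (-1) 1
  val_inv := by simp
  inv_val := by simp

theorem lX_eq (R : Type) [CommRing R] :
    HahnSeries.ofPowerSeries ℤ R PowerSeries.X = (lX R : LaurentSeries R) := by
  simp [lX]

theorem laurent_denom {R : Type} [CommRing R] (x : LaurentSeries R) :
    ∃ K : ℕ, ∀ L, K ≤ L → ∃ p : PowerSeries R,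
      x * (lX R : LaurentSeries R) ^ L = HahnSeries.ofPowerSeries ℤ R p := by
  obtain ⟨⟨p, ⟨_, K, rfl⟩⟩, hp⟩ := IsLocalization.surj
    (Submonoid.powers (PowerSeries.X : PowerSeries R)) x
  refine ⟨K, fun L hL => ⟨p * PowerSeries.X ^ (L - K), ?_⟩⟩
  simp only [LaurentSeries.coe_algebraMap, map_pow, lX_eq] at hp
  rw [map_mul, map_pow, lX_eq, ← hp, mul_assoc, ← pow_add, Nat.add_sub_cancel' hL]

theorem laurent_denoms {R : Type} [CommRing R] {n : ℕ} (x : Fin n → LaurentSeries R) :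
    ∃ K : ℕ, ∃ p : Fin n → PowerSeries R, ∀ i,
      x i * (lX R : LaurentSeries R) ^ K = HahnSeries.ofPowerSeries ℤ R (p i) := by
  choose K hK using fun i => laurent_denom (x i)
  refine ⟨Finset.univ.sup K, ?_⟩
  choose p hp using fun i => hK i (Finset.univ.sup K) (Finset.le_sup (Finset.mem_univ i))
  exact ⟨p, hp⟩

theorem laurent_rows {R : Type} [CommRing R] [IsLocalRing R]
    (H : ∀ (n N : ℕ) (a w : Fin (n + 2) → R[X]), (a 0).Monic → a ⬝ᵥ w = X ^ N →
      CplRow (fun i => HahnSeries.ofPowerSeries ℤ R (a i : PowerSeries R))) :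
    ∀ n (v w : Fin (n + 1) → LaurentSeries R), v ⬝ᵥ w = 1 → CplRow v := by
  intro n v w hvw
  cases n with
  | zero =>
    have h1 : v 0 * w 0 = 1 := by simpa [dotProduct] using hvw
    refine ⟨Matrix.diagonal w, Matrix.diagonal v, ?_, ?_⟩
    · rw [Matrix.diagonal_mul_diagonal]
      ext i j
      fin_cases i; fin_cases j
      simp [mul_comm, h1]
    · funext i
      fin_cases i
      change Matrix.vecMul v (Matrix.diagonal w) 0 = _
      rw [Matrix.vecMul_diagonal, h1]
      simp
  | succ n =>
    obtain ⟨K, α, hα⟩ := laurent_denoms v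
    obtain ⟨K', β, hβ⟩ := laurent_denoms w
    have hαβ : α ⬝ᵥ β = PowerSeries.X ^ (K + K') := by
      apply HahnSeries.ofPowerSeries_injective (Γ := ℤ) (R := R)
      rw [map_pow, lX_eq, dotProduct, map_sum]
      simp_rw [map_mul, ← hα, ← hβ]
      rw [← one_mul ((lX R : LaurentSeries R) ^ (K + K')), ← hvw, dotProduct, Finset.sum_mul]
      exact Finset.sum_congr rfl fun i _ => by ring
    obtain ⟨a, b, h1, h2, h3⟩ := move_row _ α β hαβ
    refine CplRow.of_diag (fun _ => (lX R : LaurentSeries R) ^ K)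
      (fun _ => ((lX R)⁻¹ : (LaurentSeries R)ˣ) ^ K) ?_ hα ?_
    · intro _
      rw [← mul_pow, Units.mul_inv, one_pow]
    · exact CplRow.of_congr _ α β hαβ _ h1 _ (H n _ a b h2 h3)

theorem polyToLaurentSeries {R : Type} [CommRing R] (p : R[X]) :
    HahnSeries.ofPowerSeries ℤ R (p : PowerSeries R) =
      Polynomial.eval₂ (HahnSeries.C : R →+* LaurentSeries R) (lX R : LaurentSeries R) p := by
  induction p using Polynomial.induction_on' with
  | add p q hp hq => rw [Polynomial.coe_add, map_add, hp, hq, Polynomial.eval₂_add]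
  | monomial n r =>
    rw [← Polynomial.C_mul_X_pow_eq_monomial]
    simp only [Polynomial.coe_mul, Polynomial.coe_C, Polynomial.coe_pow, Polynomial.coe_X,
      map_mul, map_pow, lX_eq, eval₂_mul, eval₂_C, eval₂_pow, eval₂_X]
    rw [HahnSeries.ofPowerSeries_C]

theorem free_laurent_of_rows (R : Type) [CommRing R] [IsRegularLocalRing R]
    (H : ∀ (n N : ℕ) (a w : Fin (n + 2) → R[X]), (a 0).Monic → a ⬝ᵥ w = X ^ N →
      CplRow (fun i => HahnSeries.ofPowerSeries ℤ R (a i : PowerSeries R))) :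
    AllFGProjectiveFree (LaurentSeries R) := by
  intro P _ _ _ _
  obtain ⟨m, n, ⟨e⟩⟩ := laurent_SF R P
  exact free_of_compl (laurent_rows H) m P n e

theorem ii_to_iv (R : Type) [CommRing R] [IsRegularLocalRing R]
    (h : AllFGProjectiveFree (LaurentPolynomial R)) :
    AllFGProjectiveFree (LaurentSeries R) := by
  apply free_laurent_of_rows
  intro n N a w _ haw
  let φ := LaurentPolynomial.eval₂ (HahnSeries.C : R →+* LaurentSeries R) (lX R)
  have hφ : ∀ p, φ (toLaurent p) = HahnSeries.ofPowerSeries ℤ R (p : PowerSeries R) := by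
    intro p
    rw [polyToLaurentSeries, LaurentPolynomial.eval₂_toLaurent]
  have h1 : CplRow (fun i => toLaurent (a i)) := by
    apply CplRow.of_allFree h _ (fun i => toLaurent (w i) * LaurentPolynomial.T (-N))
    have h2 := congrArg toLaurent haw
    rw [Polynomial.toLaurent_X_pow, dotProduct, map_sum] at h2
    have h3 : (LaurentPolynomial.T (N : ℤ) : LaurentPolynomial R) * LaurentPolynomial.T (-N) = 1 := by
      rw [← LaurentPolynomial.T_add]; simp
    rw [← h3, ← h2, dotProduct, Finset.sum_mul]
    exact Finset.sum_congr rfl fun i _ => by rw [map_mul, mul_assoc]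
  have h2 := h1.map φ
  simp_rw [hφ] at h2
  exact h2

theorem exists_reflect {R : Type} [CommRing R] (p : R[X]) :
    HahnSeries.ofPowerSeries ℤ R (p : PowerSeries R) =
      Polynomial.eval₂ (HahnSeries.C : R →+* LaurentSeries R)
        ((lX R)⁻¹ : (LaurentSeries R)ˣ) p.reverse * (lX R : LaurentSeries R) ^ p.natDegree := by
  rw [polyToLaurentSeries]
  let _ : Invertible (lX R : LaurentSeries R) := (lX R).invertible
  have := Polynomial.eval₂_reverse_mul_pow (HahnSeries.C : R →+* LaurentSeries R)
    ((lX R : LaurentSeries R)) (f := p)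
  rw [← this]
  simp

theorem reverse_unimodular {R : Type} [CommRing R] [Nontrivial R] {n N : ℕ}
    (a w : Fin (n + 1) → R[X])
    (h0 : (a 0).Monic) (haw : a ⬝ᵥ w = X ^ N) :
    ∃ w', (fun i => (a i).reverse) ⬝ᵥ w' = 1 := by
  let M := N + ∑ i, ((a i).natDegree + (w i).natDegree)
  have hM : ∀ i, (a i).natDegree + (w i).natDegree ≤ M := fun i =>
    (Finset.single_le_sum (f := fun i => (a i).natDegree + (w i).natDegree)
      (fun _ _ => Nat.zero_le _) (Finset.mem_univ i)).trans (Nat.le_add_left _ _)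
  have h1 : ∑ i, (a i).reverse * (w i).reflect (M - (a i).natDegree) = X ^ (M - N) := by
    have h2 := congrArg (Polynomial.reflect M) haw
    have h3 : Polynomial.reflect M (X ^ N : R[X]) = X ^ (M - N) := by
      rw [Polynomial.reflect_monomial, Polynomial.revAt_le (Nat.le_add_right _ _)]
    have h4 : Polynomial.reflect M (a ⬝ᵥ w) = ∑ i, Polynomial.reflect M (a i * w i) := by
      let φ : R[X] →+ R[X] := ⟨⟨Polynomial.reflect M, by simp⟩, fun x y => by simp⟩
      exact map_sum φ (fun i => a i * w i) Finset.univ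
    rw [h3, h4] at h2
    rw [← h2]
    refine Finset.sum_congr rfl fun i _ => ?_
    have := hM i
    have h5 := Polynomial.reflect_mul (a i) (w i) (F := (a i).natDegree)
      (G := M - (a i).natDegree) le_rfl (by omega)
    rw [Nat.add_sub_cancel' (by omega)] at h5
    rw [h5, Polynomial.reverse]
  let I : Ideal R[X] := Ideal.span (Set.range fun i => (a i).reverse)
  have haI : ∀ i, (a i).reverse ∈ I := fun i => Ideal.subset_span ⟨i, rfl⟩
  have hX : X ^ (M - N) ∈ I := by
    rw [← h1]
    exact Ideal.sum_mem _ fun i _ => Ideal.mul_mem_right _ _ (haI i)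
  have hc : IsCoprime ((a 0).reverse) (X ^ (M - N) : R[X]) := by
    apply IsCoprime.pow_right
    obtain ⟨c, hc⟩ : X ∣ (a 0).reverse - 1 := by
      rw [Polynomial.X_dvd_iff, coeff_sub, Polynomial.coeff_zero_reverse, h0.leadingCoeff]
      simp
    exact ⟨1, -c, by linear_combination hc⟩
  obtain ⟨r, s, hrs⟩ := hc
  have h1I : (1 : R[X]) ∈ I := by
    rw [← hrs]
    exact add_mem (Ideal.mul_mem_left _ _ (haI 0)) (Ideal.mul_mem_left _ _ hX)
  obtain ⟨w', hw⟩ := (Submodule.mem_span_range_iff_exists_fun R[X]).1 h1I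
  refine ⟨w', ?_⟩
  rw [← hw, dotProduct]
  exact Finset.sum_congr rfl fun i _ => by rw [smul_eq_mul, mul_comm]

theorem i_to_iv (R : Type) [CommRing R] [IsRegularLocalRing R]
    (h : AllFGProjectiveFree (Polynomial R)) :
    AllFGProjectiveFree (LaurentSeries R) := by
  apply free_laurent_of_rows
  intro n N a w h0 haw
  obtain ⟨w', hw'⟩ := reverse_unimodular a w h0 haw
  have h1 := CplRow.of_allFree h _ _ hw'
  have h2 := h1.map (Polynomial.eval₂RingHom (HahnSeries.C : R →+* LaurentSeries R)
        ((lX R)⁻¹ : (LaurentSeries R)ˣ))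
  refine CplRow.of_diag (fun i => (((lX R)⁻¹ : (LaurentSeries R)ˣ) : LaurentSeries R) ^ (a i).natDegree)
    (fun i => (lX R : LaurentSeries R) ^ (a i).natDegree) ?_ ?_ h2
  · intro _
    rw [← mul_pow, Units.inv_mul, one_pow]
  · intro i
    rw [exists_reflect, mul_assoc, ← mul_pow, Units.mul_inv, one_pow, mul_one]
    rfl


section kappa
variable {R : Type} [CommRing R]

/-- Laurent series of order at least `K`. -/
def VSm (K : ℤ) (x : LaurentSeries R) : Prop :=
  ∃ r : PowerSeries R, x = ((lX R ^ K : (LaurentSeries R)ˣ) : LaurentSeries R) *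
    HahnSeries.ofPowerSeries ℤ R r

theorem VSm.add {K : ℤ} {x y : LaurentSeries R} (hx : VSm K x) (hy : VSm K y) :
    VSm K (x + y) := by
  obtain ⟨r, rfl⟩ := hx
  obtain ⟨s, rfl⟩ := hy
  exact ⟨r + s, by rw [map_add, mul_add]⟩

theorem VSm.zero (K : ℤ) : VSm K (0 : LaurentSeries R) := ⟨0, by simp⟩

theorem VSm.mul {K L : ℤ} {x y : LaurentSeries R} (hx : VSm K x) (hy : VSm L y) :
    VSm (K + L) (x * y) := by
  obtain ⟨r, rfl⟩ := hx
  obtain ⟨s, rfl⟩ := hy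
  refine ⟨r * s, ?_⟩
  rw [map_mul, zpow_add, Units.val_mul]
  ring

theorem VSm.mono {K L : ℤ} (h : L ≤ K) {x : LaurentSeries R} (hx : VSm K x) : VSm L x := by
  obtain ⟨r, rfl⟩ := hx
  refine ⟨PowerSeries.X ^ (K - L).toNat * r, ?_⟩
  rw [map_mul, map_pow, lX_eq, ← mul_assoc]
  congr 1
  rw [← Units.val_pow_eq_pow_val, ← Units.val_mul, ← zpow_natCast, ← zpow_add]
  congr 2
  omega

theorem VSm.exists (x : LaurentSeries R) : ∃ K : ℕ, VSm (-K) x := by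
  obtain ⟨K, hK⟩ := laurent_denom x
  obtain ⟨p, hp⟩ := hK K le_rfl
  refine ⟨K, p, ?_⟩
  rw [← hp, mul_comm, mul_assoc, ← Units.val_pow_eq_pow_val, ← Units.val_mul]
  simp

theorem VSm.exists_mat {m n : ℕ} (x : Matrix (Fin m) (Fin n) (LaurentSeries R)) :
    ∃ K : ℕ, ∀ i j, VSm (-K) (x i j) := by
  choose K hK using fun i j => VSm.exists (x i j)
  refine ⟨Finset.univ.sup fun i => Finset.univ.sup (K i), fun i j => (hK i j).mono ?_⟩
  have h1 : K i j ≤ Finset.univ.sup (K i) := Finset.le_sup (Finset.mem_univ j)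
  have h2 : Finset.univ.sup (K i) ≤ Finset.univ.sup fun i => Finset.univ.sup (K i) :=
    Finset.le_sup (f := fun i => Finset.univ.sup (K i)) (Finset.mem_univ i)
  omega

theorem VSm.mat_mul {m n k : ℕ} {K L : ℤ} {x : Matrix (Fin m) (Fin n) (LaurentSeries R)}
    {y : Matrix (Fin n) (Fin k) (LaurentSeries R)} (hx : ∀ i j, VSm K (x i j))
    (hy : ∀ i j, VSm L (y i j)) : ∀ i j, VSm (K + L) ((x * y) i j) := by
  intro i j
  rw [Matrix.mul_apply]
  exact Finset.sum_induction _ (VSm (K + L)) (fun _ _ => VSm.add) (VSm.zero _)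
    fun l _ => (hx i l).mul (hy l j)

variable (R) in
/-- The map `R[t] → R((X))`, `t ↦ X⁻¹`. -/
noncomputable def kap0 : R[X] →+* LaurentSeries R :=
  Polynomial.eval₂RingHom (HahnSeries.C : R →+* LaurentSeries R)
        ((lX R)⁻¹ : (LaurentSeries R)ˣ)

theorem kap0_eq (p : R[X]) : kap0 R p =
    HahnSeries.ofPowerSeries ℤ R (p.reverse : PowerSeries R) *
      (((lX R)⁻¹ : (LaurentSeries R)ˣ) : LaurentSeries R) ^ p.natDegree := by
  let _ : Invertible (((lX R)⁻¹ : (LaurentSeries R)ˣ) : LaurentSeries R) := ((lX R)⁻¹).invertible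
  have := Polynomial.eval₂_reverse_mul_pow (HahnSeries.C : R →+* LaurentSeries R)
    ((((lX R)⁻¹ : (LaurentSeries R)ˣ) : LaurentSeries R)) (f := p)
  rw [polyToLaurentSeries]
  change eval₂ _ _ _ = _
  rw [← this]
  simp

theorem kap0_unit (f : monicSubmonoid R) : IsUnit (kap0 R f) := by
  have hf : (f : R[X]).Monic := f.2
  rw [kap0_eq]
  refine IsUnit.mul ?_ ((Units.isUnit _).pow _)
  apply IsUnit.map
  rw [PowerSeries.isUnit_iff_constantCoeff, ← PowerSeries.coeff_zero_eq_constantCoeff_apply,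
    Polynomial.coeff_coe, Polynomial.coeff_zero_reverse, hf.leadingCoeff]
  exact isUnit_one

variable (R) in
/-- The map `R⟨t⟩ → R((X))`, `t ↦ X⁻¹`. -/
noncomputable def kap : MonicLoc R →+* LaurentSeries R :=
  IsLocalization.lift (M := monicSubmonoid R) (g := kap0 R) kap0_unit

theorem kap_algebraMap (p : R[X]) : kap R (algebraMap R[X] (MonicLoc R) p) = kap0 R p :=
  IsLocalization.lift_eq _ _

variable (R) in
theorem exists_tinv : ∃ s : (MonicLoc R)ˣ, kap R s = (lX R : LaurentSeries R) ∧
    kap R (s⁻¹ : (MonicLoc R)ˣ) = ((lX R)⁻¹ : (LaurentSeries R)ˣ) := by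
  have h := IsLocalization.map_units (MonicLoc R) (⟨X, monic_X⟩ : monicSubmonoid R)
  obtain ⟨u, hu⟩ := h
  have h1 : kap R u = ((lX R)⁻¹ : (LaurentSeries R)ˣ) := by
    rw [hu, kap_algebraMap]
    simp [kap0]
  have h2 : Units.map (kap R : MonicLoc R →* LaurentSeries R) u = (lX R)⁻¹ := Units.ext h1
  refine ⟨u⁻¹, ?_, by rw [inv_inv]; exact h1⟩
  have h3 : Units.map (kap R : MonicLoc R →* LaurentSeries R) u⁻¹ = (lX R) := by
    rw [map_inv, h2, inv_inv]
  exact congrArg Units.val h3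

theorem kap_dense (x : LaurentSeries R) (K : ℕ) : ∃ l : MonicLoc R, VSm K (kap R l - x) := by
  obtain ⟨L, p, hp⟩ := VSm.exists x
  obtain ⟨s, hs, hs'⟩ := exists_tinv R
  obtain ⟨r, hr⟩ := trunc_dvd (L + K) p
  let q := PowerSeries.trunc (L + K) p
  refine ⟨(s⁻¹ : (MonicLoc R)ˣ) ^ L *
    Polynomial.eval₂ ((algebraMap R[X] (MonicLoc R)).comp C) s q, r, ?_⟩
  have h1 : kap R (Polynomial.eval₂ ((algebraMap R[X] (MonicLoc R)).comp C) s q) =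
      HahnSeries.ofPowerSeries ℤ R (q : PowerSeries R) := by
    rw [polyToLaurentSeries, Polynomial.hom_eval₂, hs]
    congr 1
    ext1 r
    simp only [RingHom.comp_apply, kap_algebraMap]
    simp [kap0]
  have h2 : HahnSeries.ofPowerSeries ℤ R (q : PowerSeries R) =
      HahnSeries.ofPowerSeries ℤ R p + (lX R : LaurentSeries R) ^ (L + K) *
        HahnSeries.ofPowerSeries ℤ R r := by
    rw [← lX_eq, ← map_pow, ← map_mul, ← hr, ← map_add]
    simp [q]
  rw [map_mul, map_pow, hs', h1, h2, hp]
  have h3 : (((lX R) ^ (-(L : ℤ)) : (LaurentSeries R)ˣ) : LaurentSeries R) =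
      (((lX R)⁻¹ : (LaurentSeries R)ˣ) : LaurentSeries R) ^ L := by
    rw [← Units.val_pow_eq_pow_val]
    simp
  have h4 : (((lX R)⁻¹ : (LaurentSeries R)ˣ) : LaurentSeries R) ^ L * (lX R : LaurentSeries R) ^ L = 1 := by
    rw [← mul_pow, Units.inv_mul, one_pow]
  rw [h3, zpow_natCast, Units.val_pow_eq_pow_val, pow_add]
  linear_combination (lX R : LaurentSeries R) ^ K * HahnSeries.ofPowerSeries ℤ R r * h4

theorem kap_dense_mat {m n : ℕ} (x : Matrix (Fin m) (Fin n) (LaurentSeries R)) (K : ℕ) :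
    ∃ l : Matrix (Fin m) (Fin n) (MonicLoc R), ∀ i j, VSm K ((l.map (kap R) - x) i j) := by
  choose l hl using fun i j => kap_dense (x i j) K
  exact ⟨l, hl⟩

theorem kap_isUnit [Nontrivial R] (l : MonicLoc R) (u : PowerSeries R)
    (hu : PowerSeries.constantCoeff u = 1)
    (h : kap R l = HahnSeries.ofPowerSeries ℤ R u) : IsUnit l := by
  obtain ⟨⟨p, f⟩, hp⟩ := IsLocalization.surj (monicSubmonoid R) l
  have hf : (f : R[X]).Monic := f.2
  simp only at hp
  suffices hm : p.Monic by
    have h1 : IsUnit (algebraMap R[X] (MonicLoc R) p) :=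
      IsLocalization.map_units (MonicLoc R) (⟨p, hm⟩ : monicSubmonoid R)
    rw [← hp] at h1
    exact isUnit_of_mul_isUnit_left h1
  have h2 := congrArg (kap R) hp
  rw [map_mul, kap_algebraMap, kap_algebraMap, h, kap0_eq, kap0_eq] at h2
  set a := p.natDegree
  set b := (f : R[X]).natDegree
  have h3 : (((lX R)⁻¹ : (LaurentSeries R)ˣ) : LaurentSeries R) ^ a * (lX R : LaurentSeries R) ^ a = 1 := by
    rw [← mul_pow, Units.inv_mul, one_pow]
  have h4 : (((lX R)⁻¹ : (LaurentSeries R)ˣ) : LaurentSeries R) ^ b * (lX R : LaurentSeries R) ^ b = 1 := by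
    rw [← mul_pow, Units.inv_mul, one_pow]
  have h5 : (p.reverse : PowerSeries R) * PowerSeries.X ^ b =
      (u * ((f : R[X]).reverse : PowerSeries R)) * PowerSeries.X ^ a := by
    apply HahnSeries.ofPowerSeries_injective (Γ := ℤ) (R := R)
    simp only [map_mul, map_pow, lX_eq]
    linear_combination (-(lX R : LaurentSeries R) ^ a * (lX R : LaurentSeries R) ^ b) * h2 -
      HahnSeries.ofPowerSeries ℤ R (p.reverse : PowerSeries R) * (lX R : LaurentSeries R) ^ b * h3 +
      HahnSeries.ofPowerSeries ℤ R u *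
        HahnSeries.ofPowerSeries ℤ R ((f : R[X]).reverse : PowerSeries R) *
        (lX R : LaurentSeries R) ^ a * h4
  have hc1 : PowerSeries.coeff 0 (u * ((f : R[X]).reverse : PowerSeries R)) = 1 := by
    rw [PowerSeries.coeff_zero_eq_constantCoeff_apply, map_mul, hu,
      ← PowerSeries.coeff_zero_eq_constantCoeff_apply,
      Polynomial.coeff_coe, Polynomial.coeff_zero_reverse, hf.leadingCoeff, one_mul]
  have hc2 : PowerSeries.coeff 0 (p.reverse : PowerSeries R) = p.leadingCoeff := by
    rw [Polynomial.coeff_coe, Polynomial.coeff_zero_reverse]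
  rcases lt_trichotomy a b with hab | hab | hab
  · have h6 := congrArg (PowerSeries.coeff a) h5
    rw [PowerSeries.coeff_mul_X_pow', PowerSeries.coeff_mul_X_pow', if_neg (by omega),
      if_pos le_rfl, Nat.sub_self, hc1] at h6
    exact absurd h6 zero_ne_one
  · have h6 := congrArg (PowerSeries.coeff a) h5
    rw [← hab, PowerSeries.coeff_mul_X_pow', PowerSeries.coeff_mul_X_pow', if_pos le_rfl,
      if_pos le_rfl, Nat.sub_self, hc1, hc2] at h6
    exact h6
  · have h6 := congrArg (PowerSeries.coeff b) h5
    rw [PowerSeries.coeff_mul_X_pow', PowerSeries.coeff_mul_X_pow', if_neg (show ¬ a ≤ b by omega),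
      if_pos le_rfl, Nat.sub_self, hc2] at h6
    have h7 : p = 0 := leadingCoeff_eq_zero.1 h6
    simp [a, h7] at hab

theorem kap_isUnit_mat [Nontrivial R] {n : ℕ} (A : Matrix (Fin n) (Fin n) (MonicLoc R))
    (h : ∀ i j, VSm 1 ((A.map (kap R) - 1) i j)) : IsUnit A := by
  rw [Matrix.isUnit_iff_isUnit_det]
  choose r hr using h
  let U : Matrix (Fin n) (Fin n) (PowerSeries R) :=
    1 + (PowerSeries.X : PowerSeries R) • Matrix.of r
  apply kap_isUnit _ U.det
  · rw [RingHom.map_det]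
    have : (PowerSeries.constantCoeff (R := R)).mapMatrix U = 1 := by
      ext i j
      simp [U, Matrix.one_apply]
    rw [this, Matrix.det_one]
  · rw [RingHom.map_det, RingHom.map_det]
    congr 1
    ext1 i j
    have := hr i j
    simp only [RingHom.mapMatrix_apply, Matrix.map_apply, U, map_add, map_mul, lX_eq,
      Matrix.sub_apply, zpow_one, Matrix.add_apply, Matrix.smul_apply, Matrix.of_apply,
      smul_eq_mul] at this ⊢
    rw [← this]
    simp only [Matrix.one_apply]
    split_ifs <;> simp

end kappa


theorem idem_split {B : Type} [CommRing B] [Nontrivial B] (H : AllFGProjectiveFree B) {n : ℕ}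
    (e : Matrix (Fin n) (Fin n) B) (he : e * e = e) :
    ∃ (k : ℕ) (b : Matrix (Fin n) (Fin k) B) (c : Matrix (Fin k) (Fin n) B),
      c * e * b = 1 ∧ e * b * (c * e) = e := by
  let E := Matrix.toLin' e
  have hE : ∀ x, E (E x) = E x := fun x => by
    simp only [E, Matrix.toLin'_apply, Matrix.mulVec_mulVec, he]
  let P := LinearMap.range E
  let π : (Fin n → B) →ₗ[B] P := E.rangeRestrict
  have hπ : ∀ p : P, π p = p := by
    rintro ⟨_, x, rfl⟩
    exact Subtype.ext (hE x)
  have h1 : Module.Projective B P :=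
    Module.Projective.of_split P.subtype π (LinearMap.ext hπ)
  have h2 : Module.Finite B P := Module.Finite.of_surjective π fun p => ⟨p, hπ p⟩
  have h3 : Module.Free B P := H P
  let bas := Module.finBasis B P
  let b' : (Fin (Module.finrank B P) → B) →ₗ[B] (Fin n → B) :=
    P.subtype ∘ₗ bas.equivFun.symm.toLinearMap
  let c' : (Fin n → B) →ₗ[B] (Fin (Module.finrank B P) → B) := bas.equivFun.toLinearMap ∘ₗ π
  have hEb : E ∘ₗ b' = b' := LinearMap.ext fun x => congrArg Subtype.val (hπ (bas.equivFun.symm x))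
  have hcE : c' ∘ₗ E = c' := LinearMap.ext fun x => by
    have : π (E x) = π x := hπ (π x)
    simp [c', this]
  have hcb : c' ∘ₗ b' = LinearMap.id := LinearMap.ext fun x => by
    change bas.equivFun (π (bas.equivFun.symm x : P)) = x
    rw [hπ, LinearEquiv.apply_symm_apply]
  have hbc : b' ∘ₗ c' = E := LinearMap.ext fun x => by
    simp [c', b']
    rfl
  have heE : e = LinearMap.toMatrix' E := by simp [E]
  refine ⟨Module.finrank B P, LinearMap.toMatrix' b', LinearMap.toMatrix' c', ?_, ?_⟩
  · rw [heE, ← LinearMap.toMatrix'_comp, ← LinearMap.toMatrix'_comp, hcE, hcb,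
      LinearMap.toMatrix'_id]
  · rw [heE, ← LinearMap.toMatrix'_comp, ← LinearMap.toMatrix'_comp, ← LinearMap.toMatrix'_comp,
      hcE, hEb, hbc]

theorem mat_expand1 {B : Type} [CommRing B] {n k : ℕ} (e : Matrix (Fin n) (Fin n) B)
    (b β : Matrix (Fin n) (Fin k) B) (c γ : Matrix (Fin k) (Fin n) B) :
    (c + γ) * e * (b + β) - c * e * b = γ * e * b + c * e * β + γ * e * β := by
  simp only [Matrix.add_mul, Matrix.mul_add]
  abel

theorem mat_expand2 {B : Type} [CommRing B] {n k : ℕ} (e : Matrix (Fin n) (Fin n) B)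
    (b β : Matrix (Fin n) (Fin k) B) (c γ : Matrix (Fin k) (Fin n) B)
    (h : e * b * (c * e) = e) :
    1 - e + e * (b + β) * ((c + γ) * e) - 1 =
      e * b * (γ * e) + e * β * (c * e) + e * β * (γ * e) := by
  simp only [Matrix.add_mul, Matrix.mul_add, h]
  abel

set_option maxHeartbeats 1000000 in
theorem iv_to_iii (R : Type) [CommRing R] [Nontrivial R]
    (H : AllFGProjectiveFree (LaurentSeries R)) : AllFGProjectiveFree (MonicLoc R) := by
  intro P _ _ _ _
  obtain ⟨n, π, hπ⟩ := Module.Finite.exists_fin' (MonicLoc R) P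
  obtain ⟨s, hs⟩ := Module.projective_lifting_property π LinearMap.id hπ
  have hs' : ∀ p, π (s p) = p := fun p => LinearMap.congr_fun hs p
  let e := LinearMap.toMatrix' (s ∘ₗ π)
  have hee : e * e = e := by
    change LinearMap.toMatrix' (s ∘ₗ π) * LinearMap.toMatrix' (s ∘ₗ π) = LinearMap.toMatrix' (s ∘ₗ π)
    rw [← LinearMap.toMatrix'_comp]
    congr 1
    refine LinearMap.ext fun x => ?_
    change s (π (s (π x))) = s (π x)
    rw [hs']
  let κ := kap R
  let ê := e.map κ
  have hêê : ê * ê = ê := by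
    change e.map κ * e.map κ = e.map κ
    rw [← Matrix.map_mul, hee]
  obtain ⟨k, b, c, hcb, hbc⟩ := idem_split H ê hêê
  obtain ⟨Kb, hKb⟩ := VSm.exists_mat b
  obtain ⟨Kc, hKc⟩ := VSm.exists_mat c
  obtain ⟨Ke, hKe⟩ := VSm.exists_mat ê
  let M : ℕ := Kb + Kc + 2 * Ke + 1
  obtain ⟨l, hl⟩ := kap_dense_mat b M
  obtain ⟨m, hm⟩ := kap_dense_mat c M
  obtain ⟨β, hβ⟩ : ∃ β, β = l.map κ - b := ⟨_, rfl⟩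
  obtain ⟨γ, hγ⟩ : ∃ γ, γ = m.map κ - c := ⟨_, rfl⟩
  have hl' : ∀ i j, VSm M (β i j) := by rw [hβ]; exact hl
  have hm' : ∀ i j, VSm M (γ i j) := by rw [hγ]; exact hm
  have hlκ : l.map κ = b + β := by rw [hβ]; abel
  have hmκ : m.map κ = c + γ := by rw [hγ]; abel
  have hU1 : IsUnit (m * e * l) := by
    apply kap_isUnit_mat
    have h1 : (m * e * l).map (kap R) - 1 = γ * ê * b + c * ê * β + γ * ê * β := by
      change (m * e * l).map κ - 1 = _
      rw [Matrix.map_mul, Matrix.map_mul, hlκ, hmκ, ← hcb]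
      change (c + γ) * ê * (b + β) - _ = _
      exact mat_expand1 _ _ _ _ _
    rw [h1]
    intro i j
    simp only [Matrix.add_apply]
    refine VSm.add (VSm.add ?_ ?_) ?_
    · exact (VSm.mat_mul (VSm.mat_mul hm' hKe) hKb i j).mono (by simp only [M]; push_cast; omega)
    · exact (VSm.mat_mul (VSm.mat_mul hKc hKe) hl' i j).mono (by simp only [M]; push_cast; omega)
    · exact (VSm.mat_mul (VSm.mat_mul hm' hKe) hl' i j).mono (by simp only [M]; push_cast; omega)
  have hU2 : IsUnit (1 - e + e * l * (m * e)) := by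
    apply kap_isUnit_mat
    have h1 : (1 - e + e * l * (m * e)).map (kap R) - 1 =
        ê * b * (γ * ê) + ê * β * (c * ê) + ê * β * (γ * ê) := by
      change (1 - e + e * l * (m * e)).map κ - 1 = _
      rw [Matrix.map_add κ (map_add κ), Matrix.map_sub κ (map_sub κ),
        Matrix.map_one κ (map_zero κ) (map_one κ),
        Matrix.map_mul, Matrix.map_mul, Matrix.map_mul, hlκ, hmκ]
      change 1 - ê + ê * (b + β) * ((c + γ) * ê) - 1 = _
      exact mat_expand2 _ _ _ _ _ hbc
    rw [h1]
    intro i j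
    simp only [Matrix.add_apply]
    refine VSm.add (VSm.add ?_ ?_) ?_
    · exact (VSm.mat_mul (VSm.mat_mul hKe hKb) (VSm.mat_mul hm' hKe) i j).mono
        (by simp only [M]; push_cast; omega)
    · exact (VSm.mat_mul (VSm.mat_mul hKe hl') (VSm.mat_mul hKc hKe) i j).mono
        (by simp only [M]; push_cast; omega)
    · exact (VSm.mat_mul (VSm.mat_mul hKe hl') (VSm.mat_mul hm' hKe) i j).mono
        (by simp only [M]; push_cast; omega)
  have hel : ∀ x, e.mulVec x = s (π x) := fun x => by
    rw [← Matrix.toLin'_apply]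
    simp [e]
  let φ : (Fin k → MonicLoc R) →ₗ[MonicLoc R] P := π ∘ₗ Matrix.toLin' l
  have hinj : Function.Injective φ := by
    obtain ⟨u, hu⟩ := hU1
    have h1 : (u⁻¹ : (Matrix (Fin k) (Fin k) (MonicLoc R))ˣ).val * (m * e * l) = 1 := by
      rw [← hu, Units.inv_mul]
    intro x y hxy
    have h2 : (m * e * l).mulVec x = (m * e * l).mulVec y := by
      rw [← Matrix.mulVec_mulVec, ← Matrix.mulVec_mulVec, ← Matrix.mulVec_mulVec,
        ← Matrix.mulVec_mulVec, hel, hel]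
      have : π (l.mulVec x) = π (l.mulVec y) := hxy
      rw [this]
    have h3 := congrArg (Matrix.mulVec (u⁻¹ : (Matrix (Fin k) (Fin k) (MonicLoc R))ˣ).val) h2
    simpa only [Matrix.mulVec_mulVec, h1, Matrix.one_mulVec] using h3
  have hsurj : Function.Surjective φ := by
    obtain ⟨u, hu⟩ := hU2
    have h1 : (1 - e + e * l * (m * e)) *
        (u⁻¹ : (Matrix (Fin n) (Fin n) (MonicLoc R))ˣ).val = 1 := by
      rw [← hu, Units.mul_inv]
    intro p
    let y := (u⁻¹ : (Matrix (Fin n) (Fin n) (MonicLoc R))ˣ).val.mulVec (s p)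
    have h2 : (1 - e + e * l * (m * e)).mulVec y = s p := by
      simp only [y, Matrix.mulVec_mulVec, h1, Matrix.one_mulVec]
    refine ⟨(m * e).mulVec y, ?_⟩
    have h3 := congrArg π h2
    rw [Matrix.add_mulVec, Matrix.sub_mulVec, Matrix.one_mulVec, map_add, map_sub, hel, hs', hs',
      sub_self, zero_add, ← Matrix.mulVec_mulVec, ← Matrix.mulVec_mulVec, hel, hs'] at h3
    exact h3
  exact Module.Free.of_equiv (LinearEquiv.ofBijective φ ⟨hinj, hsurj⟩)


theorem wf_span {R V ι : Type} [CommRing R] [AddCommGroup V] [Module R V] [LinearOrder ι]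
    [WellFoundedLT ι] (b : ι → V) (hb : Submodule.span R (Set.range b) = ⊤) (Y : Submodule R V)
    (S : Set ι) (h : ∀ i, i ∉ S → b i ∈ Y ⊔ Submodule.span R (b '' Set.Iio i)) :
    Y ⊔ Submodule.span R (b '' S) = ⊤ := by
  rw [eq_top_iff, ← hb, Submodule.span_le]
  rintro _ ⟨i, rfl⟩
  induction i using WellFoundedLT.induction with
  | ind i ih =>
    by_cases hi : i ∈ S
    · exact Submodule.mem_sup_right (Submodule.subset_span ⟨i, hi, rfl⟩)
    · refine (sup_le le_sup_left ?_ : Y ⊔ Submodule.span R (b '' Set.Iio i) ≤ _) (h i hi)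
      rw [Submodule.span_le]
      rintro _ ⟨j, hj, rfl⟩
      exact ih j hj

theorem basis_mem_smul_top {R V ι : Type} [CommRing R] [AddCommGroup V] [Module R V]
    (b : Module.Basis ι R V) (I : Ideal R) (x : V) :
    x ∈ I • (⊤ : Submodule R V) ↔ ∀ i, b.repr x i ∈ I := by
  rw [← b.span_eq, Submodule.mem_ideal_smul_span_iff_exists_sum]
  constructor
  · rintro ⟨a, ha, rfl⟩ i
    have : (a.sum fun i c => c • b i) = Finsupp.linearCombination R b a := rfl
    rw [this, b.repr_linearCombination]
    exact ha i
  · intro h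
    refine ⟨b.repr x, h, ?_⟩
    exact b.linearCombination_repr x

theorem horrocks_split {R V ι : Type} [CommRing R] [IsLocalRing R] [IsNoetherianRing R]
    [AddCommGroup V] [Module R V] [LinearOrder ι] [WellFoundedLT ι]
    (b : Module.Basis ι R V) (N : Submodule R V)
    (hN : IsLocalRing.maximalIdeal R • (⊤ : Submodule R V) ⊓ N ≤ IsLocalRing.maximalIdeal R • N)
    (T : Set ι) (hT : T.Finite)
    (hTN : ∀ i, i ∉ T → b i ∈ N ⊔ Submodule.span R (b '' Set.Iio i))
    (M : Set ι)
    (hM : ∀ i, i ∈ M ↔ b i ∉ N ⊔ IsLocalRing.maximalIdeal R • (⊤ : Submodule R V) ⊔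
      Submodule.span R (b '' Set.Iio i)) :
    N ⊔ Submodule.span R (b '' M) = ⊤ ∧ N ⊓ Submodule.span R (b '' M) = ⊥ := by
  set m := IsLocalRing.maximalIdeal R with hm
  have hMT : M ⊆ T := by
    intro i hi
    by_contra h
    refine (hM i).1 hi ?_
    have h' : N ⊔ Submodule.span R (b '' Set.Iio i) ≤ N ⊔ m • (⊤ : Submodule R V) ⊔
      Submodule.span R (b '' Set.Iio i) := sup_le_sup_right le_sup_left _
    exact h' (hTN i h)
  have hMfin : M.Finite := hT.subset hMT
  have hspan : N ⊔ Submodule.span R (b '' M) = ⊤ := by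
    have h1 : N ⊔ Submodule.span R (b '' T) = ⊤ := wf_span b b.span_eq N T hTN
    have h2 : N ⊔ m • ⊤ ⊔ Submodule.span R (b '' M) = ⊤ := by
      refine wf_span b b.span_eq _ M fun i hi => ?_
      by_contra h
      exact hi ((hM i).2 h)
    have h3 : Submodule.span R (b '' T) ≤ N ⊔ Submodule.span R (b '' M) := by
      refine Submodule.le_of_le_smul_of_le_jacobson_bot (I := m)
        (Submodule.fg_span (hT.image b)) (IsLocalRing.maximalIdeal_le_jacobson _) ?_
      refine le_trans le_top ?_
      rw [← h2]
      refine sup_le (sup_le (le_sup_left.trans le_sup_left) ?_) (le_sup_right.trans le_sup_left)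
      rw [← h1, Submodule.smul_sup]
      exact sup_le (Submodule.smul_le_right.trans (le_sup_left.trans le_sup_left)) le_sup_right
    rw [eq_top_iff, ← h1]
    exact sup_le le_sup_left h3
  refine ⟨hspan, ?_⟩
  -- independence modulo the maximal ideal
  have hind : ∀ c : ι →₀ R, (∀ i, i ∉ M → c i = 0) → Finsupp.linearCombination R b c ∈ N →
      ∀ i, c i ∈ m := by
    intro c hc hcN
    classical
    by_contra! hne
    let s := c.support.filter (fun i => c i ∉ m)
    have hs : s.Nonempty := by
      obtain ⟨i, hi⟩ := hne
      refine ⟨i, Finset.mem_filter.2 ⟨Finsupp.mem_support_iff.2 fun h => hi ?_, hi⟩⟩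
      rw [h]; exact zero_mem _
    let i := s.max' hs
    have hi : i ∈ s := Finset.max'_mem _ _
    obtain ⟨hi1, hi2⟩ := Finset.mem_filter.1 hi
    have hiM : i ∈ M := by
      by_contra h
      exact (Finsupp.mem_support_iff.1 hi1) (hc i h)
    refine (hM i).1 hiM ?_
    have hu : IsUnit (c i) := by
      by_contra h
      exact hi2 ((IsLocalRing.mem_maximalIdeal _).2 h)
    set Z := N ⊔ m • (⊤ : Submodule R V) ⊔ Submodule.span R (b '' Set.Iio i)
    suffices h : c i • b i ∈ Z by
      obtain ⟨u, hu⟩ := hu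
      have := Z.smul_mem (u⁻¹ : Rˣ) h
      rwa [← hu, smul_smul, Units.inv_mul, one_smul] at this
    have h1 : Finsupp.linearCombination R b c = c i • b i +
        ∑ j ∈ c.support.erase i, c j • b j := by
      rw [Finsupp.linearCombination_apply, Finsupp.sum]
      exact (Finset.add_sum_erase c.support (fun j => c j • b j) hi1).symm
    have h2 : c i • b i = Finsupp.linearCombination R b c -
        ∑ j ∈ c.support.erase i, c j • b j := by rw [h1]; abel
    rw [h2]
    refine sub_mem (Submodule.mem_sup_left (Submodule.mem_sup_left hcN)) (sum_mem fun j hj => ?_)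
    by_cases hjm : c j ∈ m
    · exact Submodule.mem_sup_left (Submodule.mem_sup_right
        (Submodule.smul_mem_smul hjm trivial))
    · have hjs : j ∈ s := Finset.mem_filter.2 ⟨Finset.mem_of_mem_erase hj, hjm⟩
      have hji : j < i := lt_of_le_of_ne (Finset.le_max' _ _ hjs) (Finset.ne_of_mem_erase hj)
      exact Submodule.mem_sup_right (Submodule.smul_mem _ _ (Submodule.subset_span ⟨j, hji, rfl⟩))
  set W := Submodule.span R (b '' M) with hW
  have hindW : ∀ x ∈ N ⊓ W, x ∈ m • W ∧ x ∈ m • N := by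
    rintro x ⟨hxN, hxW⟩
    obtain ⟨c, hc, rfl⟩ := (Finsupp.mem_span_image_iff_linearCombination R).1 hxW
    have hc' : ∀ i, i ∉ M → c i = 0 := fun i hi => by
      by_contra h
      exact hi (hc (Finsupp.mem_support_iff.2 h))
    have h1 := hind c hc' hxN
    have h2 : Finsupp.linearCombination R b c ∈ m • W := by
      rw [Finsupp.linearCombination_apply, Finsupp.sum]
      refine sum_mem fun i hi => Submodule.smul_mem_smul (h1 i) (Submodule.subset_span ⟨i, hc hi, rfl⟩)
    exact ⟨h2, hN ⟨Submodule.smul_mono le_rfl le_top h2, hxN⟩⟩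
  -- splitting
  let θ : (N × W) →ₗ[R] V := N.subtype.coprod W.subtype
  have hθ : Function.Surjective θ := by
    rw [← LinearMap.range_eq_top, LinearMap.range_coprod, Submodule.range_subtype,
      Submodule.range_subtype, hspan]
  have : Module.Projective R V := Module.Projective.of_basis b
  obtain ⟨σ, hσ⟩ := Module.projective_lifting_property θ LinearMap.id hθ
  have hσ' : ∀ v, θ (σ v) = v := fun v => LinearMap.congr_fun hσ v
  -- the second component of the retraction, landing in the intersection
  let ρ : (N × W) →ₗ[R] V := W.subtype ∘ₗ LinearMap.snd R N W ∘ₗ (LinearMap.id - σ ∘ₗ θ)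
  have hρ : ∀ z, ρ z ∈ N ⊓ W := by
    intro z
    have h1 : θ (z - σ (θ z)) = 0 := by rw [map_sub, hσ', sub_self]
    have h2 : ((z - σ (θ z)).1 : V) + ((z - σ (θ z)).2 : V) = 0 := h1
    refine ⟨?_, ((z - σ (θ z)).2).2⟩
    have h3 : ρ z = - ((z - σ (θ z)).1 : V) := by
      rw [eq_neg_iff_add_eq_zero, add_comm]; exact h2
    rw [h3]
    exact neg_mem (z - σ (θ z)).1.2
  have hWfg : W.FG := Submodule.fg_span (hMfin.image b)
  have hfg : (N ⊓ W).FG := by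
    have : IsNoetherian R W := isNoetherian_of_fg_of_noetherian W hWfg
    exact (isNoetherian_submodule.1 this) _ inf_le_right
  refine Submodule.eq_bot_of_le_smul_of_le_jacobson_bot m _ hfg ?_
    (IsLocalRing.maximalIdeal_le_jacobson _)
  intro x hx
  obtain ⟨h1, h2⟩ := hindW x hx
  -- `x = ρ(-x, x)`
  have hmap1 : ∀ z ∈ m • W, ∃ z' ∈ m • (⊤ : Submodule R (N × W)), (z'.1 : V) = 0 ∧ (z'.2 : V) = z := by
    intro z hz
    have h3 : m • W = Submodule.map W.subtype (m • ⊤) := by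
      rw [Submodule.map_smul'']; simp
    rw [h3] at hz
    obtain ⟨y, hy, rfl⟩ := hz
    refine ⟨(0, y), ?_, rfl, rfl⟩
    have := Submodule.mem_map_of_mem (f := LinearMap.inr R N W) hy
    rw [Submodule.map_smul''] at this
    exact Submodule.smul_mono le_rfl le_top this
  have hmap2 : ∀ z ∈ m • N, ∃ z' ∈ m • (⊤ : Submodule R (N × W)), (z'.1 : V) = z ∧ (z'.2 : V) = 0 := by
    intro z hz
    have h3 : m • N = Submodule.map N.subtype (m • ⊤) := by
      rw [Submodule.map_smul'']; simp
    rw [h3] at hz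
    obtain ⟨y, hy, rfl⟩ := hz
    refine ⟨(y, 0), ?_, rfl, rfl⟩
    have := Submodule.mem_map_of_mem (f := LinearMap.inl R N W) hy
    rw [Submodule.map_smul''] at this
    exact Submodule.smul_mono le_rfl le_top this
  obtain ⟨z1, hz1, hz11, hz12⟩ := hmap1 x h1
  obtain ⟨z2, hz2, hz21, hz22⟩ := hmap2 x h2
  have hz : z1 - z2 ∈ m • (⊤ : Submodule R (N × W)) := sub_mem hz1 hz2
  have hθz : θ (z1 - z2) = 0 := by
    have : θ (z1 - z2) = ((z1.1 : V) - z2.1) + (z1.2 - z2.2) := rfl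
    rw [this, hz11, hz12, hz21, hz22]
    abel
  have hρz : ρ (z1 - z2) = x := by
    have : ρ (z1 - z2) = ((z1 - z2 - σ (θ (z1 - z2))).2 : V) := rfl
    rw [this, hθz, map_zero, sub_zero]
    have : ((z1 - z2).2 : V) = z1.2 - z2.2 := rfl
    rw [this, hz12, hz22, sub_zero]
  rw [← hρz]
  have := Submodule.mem_map_of_mem (f := ρ) hz
  rw [Submodule.map_smul''] at this
  refine Submodule.smul_mono le_rfl ?_ this
  rintro _ ⟨z, -, rfl⟩
  exact hρ z


theorem embed_of_loc {A B : Type} [CommRing A] [CommRing B] [Algebra A B] [Nontrivial B]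
    (S : Submonoid A) [IsLocalization S B] (hS : S ≤ nonZeroDivisors A)
    (H : AllFGProjectiveFree B) (P : Type) [AddCommGroup P] [Module A P] [Module.Finite A P]
    [Module.Projective A P] :
    ∃ (k : ℕ) (φ : P →ₗ[A] (Fin k → A)) (ψ : (Fin k → A) →ₗ[A] P) (f : A), f ∈ S ∧
      (∀ p, ψ (φ p) = f • p) ∧ ∀ x, φ (ψ x) = f • x := by
  obtain ⟨n, π, hπ⟩ := Module.Finite.exists_fin' A P
  obtain ⟨s, hs⟩ := Module.projective_lifting_property π LinearMap.id hπ
  have hs' : ∀ p, π (s p) = p := fun p => LinearMap.congr_fun hs p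
  let e := LinearMap.toMatrix' (s ∘ₗ π)
  have hee : e * e = e := by
    change LinearMap.toMatrix' (s ∘ₗ π) * LinearMap.toMatrix' (s ∘ₗ π) = LinearMap.toMatrix' (s ∘ₗ π)
    rw [← LinearMap.toMatrix'_comp]
    congr 1
    refine LinearMap.ext fun x => ?_
    change s (π (s (π x))) = s (π x)
    rw [hs']
  have hel : ∀ x, e.mulVec x = s (π x) := fun x => by
    rw [← Matrix.toLin'_apply]
    simp [e]
  let κ := algebraMap A B
  have hκ : Function.Injective κ := IsLocalization.injective B hS
  have hêê : e.map κ * e.map κ = e.map κ := by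
    rw [← Matrix.map_mul, hee]
  obtain ⟨k, b, c, hcb, hbc⟩ := idem_split H (e.map κ) hêê
  obtain ⟨fb, hfb⟩ := IsLocalization.exist_integer_multiples_of_finite S (fun ij : Fin n × Fin k => b ij.1 ij.2)
  obtain ⟨fc, hfc⟩ := IsLocalization.exist_integer_multiples_of_finite S (fun ij : Fin k × Fin n => c ij.1 ij.2)
  choose l hl using hfb
  choose m hm using hfc
  let L : Matrix (Fin n) (Fin k) A := Matrix.of fun i j => l (i, j)
  let M : Matrix (Fin k) (Fin n) A := Matrix.of fun i j => m (i, j)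
  have hL : L.map κ = κ fb • b := by
    ext i j
    have := hl (i, j)
    simp only [L, Matrix.map_apply, Matrix.of_apply, Matrix.smul_apply, smul_eq_mul]
    rw [this, Algebra.smul_def]
  have hM : M.map κ = κ fc • c := by
    ext i j
    have := hm (i, j)
    simp only [M, Matrix.map_apply, Matrix.of_apply, Matrix.smul_apply, smul_eq_mul]
    rw [this, Algebra.smul_def]
  have hinj : ∀ {p q : ℕ} (x y : Matrix (Fin p) (Fin q) A), x.map κ = y.map κ → x = y := by
    intro p q x y h
    ext i j
    exact hκ (congrFun (congrFun h i) j)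
  have h1 : M * e * L = ((fc * fb : S) : A) • 1 := by
    apply hinj
    rw [Matrix.map_mul, Matrix.map_mul, hL, hM, Matrix.smul_mul, Matrix.smul_mul, Matrix.mul_smul,
      hcb]
    ext i j
    simp only [Matrix.smul_apply, Matrix.one_apply, Matrix.map_apply, smul_eq_mul, κ]
    split_ifs <;> simp
  have h2 : e * L * (M * e) = ((fc * fb : S) : A) • e := by
    apply hinj
    rw [Matrix.map_mul, Matrix.map_mul, Matrix.map_mul, hL, hM, Matrix.smul_mul, Matrix.mul_smul,
      Matrix.mul_smul, Matrix.smul_mul, hbc]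
    ext i j
    simp only [Matrix.smul_apply, Matrix.map_apply, smul_eq_mul, κ, map_mul, Submonoid.coe_mul]
    ring
  refine ⟨k, Matrix.toLin' M ∘ₗ s, π ∘ₗ Matrix.toLin' L, (fc * fb : S), (fc * fb).2, ?_, ?_⟩
  · intro p
    have h3 := congrArg (fun x => π (Matrix.mulVec x (s p))) h2
    simp only [Matrix.smul_mulVec, map_smul] at h3
    rw [← Matrix.mulVec_mulVec, ← Matrix.mulVec_mulVec, ← Matrix.mulVec_mulVec, hel, hel, hs',
      hs', hs'] at h3
    exact h3
  · intro x
    have h3 := congrArg (fun y => Matrix.mulVec y x) h1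
    simp only [Matrix.smul_mulVec, Matrix.one_mulVec] at h3
    rw [← Matrix.mulVec_mulVec, ← Matrix.mulVec_mulVec, hel] at h3
    exact h3

/-- The monomial basis of `R[X]^k`, indexed lexicographically. -/
noncomputable def polyBasis (R : Type) [CommRing R] (k : ℕ) :
    Module.Basis (Fin k ×ₗ ℕ) R (Fin k → R[X]) :=
  (Pi.basis fun _ : Fin k => Polynomial.basisMonomials R).reindex
    ((Equiv.sigmaEquivProd (Fin k) ℕ).trans toLex)

theorem polyBasis_apply (R : Type) [CommRing R] (k : ℕ) (j : Fin k) (l : ℕ) :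
    polyBasis R k (toLex (j, l)) = Pi.single j (X ^ l) := by
  simp only [polyBasis, Module.Basis.reindex_apply]
  change (Pi.basis fun _ : Fin k => Polynomial.basisMonomials R) ⟨j, l⟩ = _
  rw [Pi.basis_apply]
  simp [X_pow_eq_monomial]

theorem polyBasis_repr (R : Type) [CommRing R] (k : ℕ) (j : Fin k) (l : ℕ) (x : Fin k → R[X]) :
    (polyBasis R k).repr x (toLex (j, l)) = (x j).coeff l := by
  simp only [polyBasis, Module.Basis.repr_reindex_apply]
  change (Pi.basis fun _ : Fin k => Polynomial.basisMonomials R).repr x ⟨j, l⟩ = _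
  rw [Pi.basis_repr]
  rfl

theorem poly_mem_smul_top {R : Type} [CommRing R] {k : ℕ} (I : Ideal R) (x : Fin k → R[X]) :
    x ∈ I • (⊤ : Submodule R (Fin k → R[X])) ↔ ∀ j l, (x j).coeff l ∈ I := by
  rw [basis_mem_smul_top (polyBasis R k)]
  constructor
  · intro h j l
    rw [← polyBasis_repr]
    exact h _
  · intro h i
    have := polyBasis_repr R k (ofLex i).1 (ofLex i).2 x
    change (polyBasis R k).repr x i = _ at this
    rw [this]
    exact h _ _

theorem free_of_gens {A : Type} [CommRing A] {k : ℕ} (N : Submodule A (Fin k → A)) (f : A)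
    (hf : f ∈ nonZeroDivisors A) (hfN : ∀ x : Fin k → A, f • x ∈ N) (r : Fin k → (Fin k → A))
    (hr : N = Submodule.span A (Set.range r)) : Module.Free A N := by
  let ν : (Fin k → A) →ₗ[A] (Fin k → A) := Fintype.linearCombination A r
  have hν : LinearMap.range ν = N := by rw [hr, Fintype.range_linearCombination]
  let ν' : (Fin k → A) →ₗ[A] N := ν.codRestrict N fun x => hν ▸ LinearMap.mem_range_self ν x
  have hν' : Function.Surjective ν' := by
    rintro ⟨x, hx⟩
    rw [← hν] at hx
    obtain ⟨y, rfl⟩ := hx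
    exact ⟨y, rfl⟩
  let τ : (Fin k → A) →ₗ[A] N := (f • LinearMap.id).codRestrict N hfN
  obtain ⟨μ, hμ⟩ := Module.projective_lifting_property ν' τ hν'
  have hμ' : ν ∘ₗ μ = f • LinearMap.id := by
    refine LinearMap.ext fun x => ?_
    exact congrArg Subtype.val (LinearMap.congr_fun hμ x)
  have hdet : LinearMap.det ν * LinearMap.det μ = f ^ Module.finrank A (Fin k → A) := by
    rw [← LinearMap.det_comp, hμ', LinearMap.det_smul]
    simp
  have hnz : LinearMap.det ν ∈ nonZeroDivisors A := by
    have h1 : LinearMap.det ν * LinearMap.det μ ∈ nonZeroDivisors A := hdet ▸ pow_mem hf _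
    exact (mul_mem_nonZeroDivisors.1 h1).1
  have hinj : Function.Injective ν := by
    rw [injective_iff_map_eq_zero]
    intro x hx
    have h1 : (LinearMap.toMatrix' ν).mulVec x = 0 := by
      rw [← Matrix.toLin'_apply, Matrix.toLin'_toMatrix', hx]
    have h2 := congrArg (Matrix.mulVec (LinearMap.toMatrix' ν).adjugate) h1
    rw [Matrix.mulVec_mulVec, Matrix.adjugate_mul, Matrix.mulVec_zero, Matrix.smul_mulVec,
      Matrix.one_mulVec, LinearMap.det_toMatrix'] at h2
    funext i
    have h3 := congrFun h2 i
    simp only [Pi.smul_apply, smul_eq_mul, Pi.zero_apply] at h3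
    exact (mem_nonZeroDivisors_iff.1 hnz).1 _ h3
  exact Module.Free.of_equiv (LinearEquiv.ofBijective ν'
    ⟨fun x y h => hinj (congrArg Subtype.val h), hν'⟩)


theorem single_mem_span_lt {R : Type} [CommRing R] {k : ℕ} (j : Fin k) (l : ℕ) (q : R[X])
    (hq : q.degree < l) :
    Pi.single j q ∈ Submodule.span R (polyBasis R k '' Set.Iio (toLex (j, l))) := by
  rw [Module.Basis.mem_span_image]
  intro i hi
  obtain ⟨⟨j', l'⟩, rfl⟩ := toLex.surjective i
  rw [Finset.mem_coe, Finsupp.mem_support_iff, polyBasis_repr] at hi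
  by_cases hj : j' = j
  · subst hj
    rw [Pi.single_eq_same] at hi
    have : l' < l := by
      by_contra h
      refine hi (coeff_eq_zero_of_degree_lt (lt_of_lt_of_le hq ?_))
      exact_mod_cast not_lt.1 h
    rw [Set.mem_Iio, Prod.Lex.toLex_lt_toLex]
    exact Or.inr ⟨rfl, this⟩
  · rw [Pi.single_eq_of_ne hj] at hi
    simp at hi

theorem horrocks_gens {R : Type} [CommRing R] [IsLocalRing R] [IsNoetherianRing R] {k : ℕ}
    (N : Submodule R[X] (Fin k → R[X])) (f : R[X]) (hf : f.Monic)
    (hfN : ∀ x : Fin k → R[X], f • x ∈ N)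
    (hN : IsLocalRing.maximalIdeal R • (⊤ : Submodule R (Fin k → R[X])) ⊓ N.restrictScalars R ≤
      IsLocalRing.maximalIdeal R • N.restrictScalars R) :
    ∃ r : Fin k → (Fin k → R[X]), N = Submodule.span R[X] (Set.range r) := by
  classical
  set m := IsLocalRing.maximalIdeal R
  let b := polyBasis R k
  have hb : ∀ j l, b (toLex (j, l)) = Pi.single j (X ^ l) := polyBasis_apply R k
  let N' := N.restrictScalars R
  let T : Set (Fin k ×ₗ ℕ) := {i | (ofLex i).2 < f.natDegree}
  have hT : T.Finite := by
    have h1 : (Set.univ ×ˢ Set.Iio f.natDegree : Set (Fin k × ℕ)).Finite :=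
      Set.finite_univ.prod (Set.finite_Iio _)
    refine (h1.image toLex).subset fun i hi => ⟨ofLex i, ⟨trivial, hi⟩, rfl⟩
  have hTN : ∀ i, i ∉ T → b i ∈ N' ⊔ Submodule.span R (b '' Set.Iio i) := by
    intro i hi
    obtain ⟨⟨j, l⟩, rfl⟩ := toLex.surjective i
    have hl : f.natDegree ≤ l := not_lt.1 hi
    have h1 : f • (Pi.single j (X ^ (l - f.natDegree)) : Fin k → R[X]) ∈ N := hfN _
    rw [hb, ← add_sub_cancel (f • (Pi.single j (X ^ (l - f.natDegree)) : Fin k → R[X]))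
      (Pi.single j (X ^ l))]
    refine Submodule.add_mem_sup h1 ?_
    rw [← Pi.single_smul, ← Pi.single_sub, smul_eq_mul]
    apply single_mem_span_lt
    have hm : (f * X ^ (l - f.natDegree)).Monic := hf.mul (monic_X_pow _)
    have hn : (f * X ^ (l - f.natDegree)).natDegree = l := by
      rw [hf.natDegree_mul (monic_X_pow _), natDegree_X_pow]
      omega
    have hd : (f * X ^ (l - f.natDegree)).degree = ((l : ℕ) : WithBot ℕ) := by
      rw [degree_eq_natDegree hm.ne_zero, hn]
    have := degree_sub_lt_left (p := X ^ l) (q := f * X ^ (l - f.natDegree))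
      (by rw [hd, degree_X_pow])
      (monic_X_pow l).ne_zero (by rw [hm.leadingCoeff, (monic_X_pow l).leadingCoeff])
    rwa [degree_X_pow] at this
  let M : Set (Fin k ×ₗ ℕ) := {i | b i ∉ N' ⊔ m • (⊤ : Submodule R (Fin k → R[X])) ⊔
      Submodule.span R (b '' Set.Iio i)}
  obtain ⟨hsup, hinf⟩ := horrocks_split b N' hN T hT hTN M (fun i => Iff.rfl)
  let ξ : (Fin k → R[X]) →ₗ[R] (Fin k → R[X]) :=
    (LinearMap.lsmul R[X] (Fin k → R[X]) X).restrictScalars R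
  have hξ : ∀ x, ξ x = (X : R[X]) • x := fun x => rfl
  have hξb : ∀ j l, ξ (b (toLex (j, l))) = b (toLex (j, l + 1)) := by
    intro j l
    rw [hξ, hb, hb, ← Pi.single_smul, smul_eq_mul, pow_succ']
  have hMT : M ⊆ T := by
    intro i hi
    by_contra h
    have h' : N' ⊔ Submodule.span R (b '' Set.Iio i) ≤ N' ⊔ m • (⊤ : Submodule R _) ⊔
      Submodule.span R (b '' Set.Iio i) := sup_le_sup_right le_sup_left _
    exact hi (h' (hTN i h))
  have hclosed : ∀ j l, toLex (j, l) ∉ M → toLex (j, l + 1) ∉ M := by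
    intro j l h h'
    have h1 : b (toLex (j, l)) ∈ N' ⊔ m • (⊤ : Submodule R (Fin k → R[X])) ⊔
      Submodule.span R (b '' Set.Iio (toLex (j, l))) := by
      by_contra h2
      exact h h2
    refine h' ?_
    have h2 := Submodule.mem_map_of_mem (f := ξ) h1
    rw [hξb, Submodule.map_sup, Submodule.map_sup, Submodule.map_smul'', Submodule.map_span] at h2
    revert h2
    apply SetLike.le_def.1
    refine sup_le_sup (sup_le_sup ?_ (Submodule.smul_mono le_rfl le_top)) ?_
    · rintro _ ⟨x, hx, rfl⟩
      exact N.smul_mem X hx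
    · rw [Submodule.span_le]
      rintro _ ⟨_, ⟨i, hi, rfl⟩, rfl⟩
      obtain ⟨⟨j', l'⟩, rfl⟩ := toLex.surjective i
      rw [hξb]
      refine Submodule.subset_span ⟨_, ?_, rfl⟩
      rw [Set.mem_Iio, Prod.Lex.toLex_lt_toLex] at hi ⊢
      rcases hi with hi | ⟨hi, hi'⟩
      · exact Or.inl hi
      · exact Or.inr ⟨hi, by simpa using hi'⟩
  have hex : ∀ j, ∃ l, toLex (j, l) ∉ M := fun j => ⟨f.natDegree, fun h => by
    have : f.natDegree < f.natDegree := hMT h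
    omega⟩
  let md : Fin k → ℕ := fun j => Nat.find (hex j)
  have hmd : ∀ j, toLex (j, md j) ∉ M := fun j => Nat.find_spec (hex j)
  have hmd' : ∀ j l, l < md j → toLex (j, l) ∈ M := fun j l h => by
    by_contra h'
    exact Nat.find_min (hex j) h h'
  set W := Submodule.span R (b '' M) with hW
  have hdec : ∀ j, ∃ r ∈ N', ∃ w ∈ W, r + w = b (toLex (j, md j)) := by
    intro j
    have : b (toLex (j, md j)) ∈ N' ⊔ W := by rw [hsup]; trivial
    exact Submodule.mem_sup.1 this
  choose r hr w hw hrw using hdec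
  refine ⟨r, ?_⟩
  set P0 := Submodule.span R[X] (Set.range r) with hP0
  have hP0N : P0 ≤ N := by
    rw [hP0, Submodule.span_le]
    rintro _ ⟨j, rfl⟩
    exact hr j
  have hrP : ∀ j, r j ∈ P0 := fun j => Submodule.subset_span ⟨j, rfl⟩
  let G := P0.restrictScalars R ⊔ W
  have hbG : ∀ j, b (toLex (j, md j)) ∈ G := fun j => by
    rw [← hrw]
    exact Submodule.add_mem_sup (hrP j) (hw j)
  have hMlt : ∀ j l, toLex (j, l) ∈ M → l < md j := by
    intro j l h
    by_contra h'
    have : ∀ l', md j ≤ l' → toLex (j, l') ∉ M := by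
      intro l' hl'
      induction l', hl' using Nat.le_induction with
      | base => exact hmd j
      | succ l' _ ih => exact hclosed j l' ih
    exact this l (not_lt.1 h') h
  have hGX : ∀ x ∈ G, ξ x ∈ G := by
    intro x hx
    have h1 : G.map ξ ≤ G := by
      rw [Submodule.map_sup]
      refine sup_le ?_ ?_
      · rintro _ ⟨x, hx, rfl⟩
        exact Submodule.mem_sup_left (P0.smul_mem X hx)
      · rw [hW, Submodule.map_span, Submodule.span_le]
        rintro _ ⟨_, ⟨i, hi, rfl⟩, rfl⟩
        obtain ⟨⟨j, l⟩, rfl⟩ := toLex.surjective i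
        rw [hξb]
        have h2 := hMlt j l hi
        by_cases h3 : l + 1 = md j
        · rw [h3]; exact hbG j
        · exact Submodule.mem_sup_right (Submodule.subset_span ⟨_, hmd' j (l + 1) (by omega), rfl⟩)
    exact h1 (Submodule.mem_map_of_mem hx)
  have hGtop : G = ⊤ := by
    rw [eq_top_iff, ← b.span_eq, Submodule.span_le]
    rintro _ ⟨i, rfl⟩
    obtain ⟨⟨j, l⟩, rfl⟩ := toLex.surjective i
    induction l with
    | zero =>
      by_cases h : md j = 0
      · have := hbG j
        rwa [h] at this
      · exact Submodule.mem_sup_right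
          (Submodule.subset_span ⟨_, hmd' j 0 (Nat.pos_of_ne_zero h), rfl⟩)
    | succ l ih =>
      have h := hGX _ ih
      rw [hξb] at h
      exact h
  refine le_antisymm ?_ hP0N
  intro x hx
  have hxG : x ∈ G := by rw [hGtop]; trivial
  obtain ⟨p, hp, y, hy, rfl⟩ := Submodule.mem_sup.1 hxG
  have hy0 : y ∈ N' ⊓ W := by
    refine ⟨?_, hy⟩
    have := N.sub_mem hx (hP0N hp)
    rwa [add_sub_cancel_left] at this
  rw [hinf, Submodule.mem_bot] at hy0
  rw [hy0, add_zero]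
  exact hp

theorem monic_mul_coeff_mem {R : Type} [CommRing R] (I : Ideal R) (f g : R[X]) (hf : f.Monic)
    (h : ∀ l, (f * g).coeff l ∈ I) : ∀ l, g.coeff l ∈ I := by
  have h1 : (f * g).map (Ideal.Quotient.mk I) = 0 := by
    ext l
    rw [coeff_map, coeff_zero, Ideal.Quotient.eq_zero_iff_mem]
    exact h l
  rw [Polynomial.map_mul] at h1
  have h2 := ((hf.map (Ideal.Quotient.mk I)).mul_right_eq_zero_iff).1 h1
  intro l
  rw [← Ideal.Quotient.eq_zero_iff_mem, ← coeff_map, h2, coeff_zero]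

theorem horrocks {R : Type} [CommRing R] [IsLocalRing R] [IsNoetherianRing R]
    (P : Type) [AddCommGroup P] [Module R[X] P] [Module.Finite R[X] P] [Module.Projective R[X] P]
    {k : ℕ} (φ : P →ₗ[R[X]] (Fin k → R[X])) (ψ : (Fin k → R[X]) →ₗ[R[X]] P) (f : R[X])
    (hf : f.Monic) (h1 : ∀ p, ψ (φ p) = f • p) (h2 : ∀ x, φ (ψ x) = f • x) :
    Module.Free R[X] P := by
  obtain ⟨n, π, hπ⟩ := Module.Finite.exists_fin' R[X] P
  obtain ⟨s, hs⟩ := Module.projective_lifting_property π LinearMap.id hπ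
  have hs' : ∀ p, π (s p) = p := fun p => LinearMap.congr_fun hs p
  have hfnz : f ∈ nonZeroDivisors R[X] := hf.mem_nonZeroDivisors
  have hinj : Function.Injective φ := by
    rw [injective_iff_map_eq_zero]
    intro p hp
    have h3 : f • p = 0 := by rw [← h1, hp, map_zero]
    have h4 : f • s p = 0 := by rw [← map_smul, h3, map_zero]
    have h5 : s p = 0 := by
      funext i
      have h6 := congrFun h4 i
      simp only [Pi.smul_apply, smul_eq_mul, Pi.zero_apply] at h6
      exact (mem_nonZeroDivisors_iff.1 hfnz).1 _ h6
    rw [← hs' p, h5, map_zero]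
  let N := LinearMap.range φ
  have hfN : ∀ x : Fin k → R[X], f • x ∈ N := fun x => ⟨ψ x, h2 x⟩
  have hN : IsLocalRing.maximalIdeal R • (⊤ : Submodule R (Fin k → R[X])) ⊓ N.restrictScalars R ≤
      IsLocalRing.maximalIdeal R • N.restrictScalars R := by
    rintro _ ⟨hx, ⟨p, rfl⟩⟩
    have h3 := Submodule.mem_map_of_mem (f := (s ∘ₗ ψ).restrictScalars R) hx
    rw [Submodule.map_smul''] at h3
    have h4 : f • s p ∈ IsLocalRing.maximalIdeal R • (⊤ : Submodule R (Fin n → R[X])) := by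
      have h5 : ((s ∘ₗ ψ).restrictScalars R) (φ p) = f • s p := by
        change s (ψ (φ p)) = _
        rw [h1, map_smul]
      rw [← h5]
      exact Submodule.smul_mono le_rfl le_top h3
    have h5 : s p ∈ IsLocalRing.maximalIdeal R • (⊤ : Submodule R (Fin n → R[X])) := by
      rw [poly_mem_smul_top] at h4 ⊢
      intro j
      exact monic_mul_coeff_mem _ f _ hf (h4 j)
    have h6 := Submodule.mem_map_of_mem (f := (φ ∘ₗ π).restrictScalars R) h5
    rw [Submodule.map_smul''] at h6
    have h7 : ((φ ∘ₗ π).restrictScalars R) (s p) = φ p := by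
      change φ (π (s p)) = _
      rw [hs']
    rw [h7] at h6
    refine Submodule.smul_mono le_rfl ?_ h6
    rintro _ ⟨x, -, rfl⟩
    exact ⟨π x, rfl⟩
  obtain ⟨r, hr⟩ := horrocks_gens N f hf hfN hN
  have : Module.Free R[X] N := free_of_gens N f hfnz hfN r hr
  exact Module.Free.of_equiv (LinearEquiv.ofInjective φ hinj).symm

theorem monicSubmonoid_le (R : Type) [CommRing R] :
    monicSubmonoid R ≤ nonZeroDivisors R[X] := fun _ hf => Polynomial.Monic.mem_nonZeroDivisors hf

theorem monicLoc_nontrivial (R : Type) [CommRing R] [Nontrivial R] : Nontrivial (MonicLoc R) :=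
  (IsLocalization.injective (MonicLoc R) (monicSubmonoid_le R)).nontrivial

theorem iii_to_i (R : Type) [CommRing R] [IsLocalRing R] [IsNoetherianRing R]
    (H : AllFGProjectiveFree (MonicLoc R)) : AllFGProjectiveFree R[X] := by
  intro P _ _ _ _
  have := monicLoc_nontrivial R
  obtain ⟨k, φ, ψ, f, hf, h1, h2⟩ := embed_of_loc (monicSubmonoid R) (monicSubmonoid_le R) H P
  exact horrocks P φ ψ f hf h1 h2


theorem lift_through {A Q M N : Type} [CommRing A] [AddCommGroup Q] [Module A Q]
    [AddCommGroup M] [Module A M] [AddCommGroup N] [Module A N]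
    (i : M →ₗ[A] N) (hi : Function.Injective i) (g : Q →ₗ[A] N) (h : ∀ q, ∃ y, i y = g q) :
    ∃ g' : Q →ₗ[A] M, ∀ q, i (g' q) = g q := by
  refine ⟨(LinearEquiv.ofInjective i hi).symm.toLinearMap ∘ₗ
    (g.codRestrict (LinearMap.range i) h), fun q => ?_⟩
  have := congrArg Subtype.val
    ((LinearEquiv.ofInjective i hi).apply_symm_apply (g.codRestrict (LinearMap.range i) h q))
  exact this

/-- the coordinatewise inclusion -/
noncomputable def coordMap (A L : Type) [CommRing A] [CommRing L] [Algebra A L] (n : ℕ) :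
    (Fin n → A) →ₗ[A] (Fin n → L) := (Algebra.linearMap A L).compLeft (Fin n)

theorem coordMap_apply (A L : Type) [CommRing A] [CommRing L] [Algebra A L] (n : ℕ)
    (v : Fin n → A) (j : Fin n) : coordMap A L n v j = algebraMap A L (v j) := rfl

theorem clear_den {A L : Type} [CommRing A] [CommRing L] [Algebra A L] (x : A)
    [IsLocalization.Away x L] {ι : Type} [Finite ι] {n : ℕ} (v : ι → Fin n → L) :
    ∃ N : ℕ, ∀ i, ∃ y, coordMap A L n y = x ^ N • v i := by
  obtain ⟨⟨_, N, rfl⟩, h⟩ := IsLocalization.exist_integer_multiples_of_finite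
    (Submonoid.powers x) (fun p : ι × Fin n => v p.1 p.2)
  refine ⟨N, fun i => ?_⟩
  choose y hy using h
  refine ⟨fun j => y (i, j), ?_⟩
  funext j
  exact hy (i, j)

theorem core_descent {A L P : Type} [CommRing A] [IsNoetherianRing A] [CommRing L] [Algebra A L]
    (x : A) [IsLocalization.Away x L] (hx : x ∈ nonZeroDivisors A)
    (H : AllFGProjectiveFree A) [AddCommGroup P] [Module L P] [Module A P] [IsScalarTower A L P]
    [Module.Finite L P] [Module.Projective L P] {k : ℕ}
    (φ : P →ₗ[L] (Fin k → L)) (ψ : (Fin k → L) →ₗ[L] P) (a : A) (hax : IsCoprime a x)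
    (hinj : Function.Injective φ)
    (h1 : ∀ p, ψ (φ p) = a • p) (h2 : ∀ v, φ (ψ v) = a • v) : Module.Free L P := by
  have hAL : Function.Injective (algebraMap A L) :=
    IsLocalization.injective L (M := Submonoid.powers x) (Submonoid.powers_le.2 hx)
  have hc : ∀ n, Function.Injective (coordMap A L n) := fun n v w h => by
    funext j
    exact hAL (congrFun h j)
  obtain ⟨r, π, hπ⟩ := Module.Finite.exists_fin' L P
  obtain ⟨s, hs⟩ := Module.projective_lifting_property π LinearMap.id hπ
  have hs' : ∀ p, π (s p) = p := fun p => LinearMap.congr_fun hs p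
  let φA : P →ₗ[A] (Fin k → L) := φ.restrictScalars A
  let ψA : (Fin k → L) →ₗ[A] P := ψ.restrictScalars A
  let sA : P →ₗ[A] (Fin r → L) := s.restrictScalars A
  let πA : (Fin r → L) →ₗ[A] P := π.restrictScalars A
  let Q : Submodule A P := (LinearMap.range (coordMap A L k)).comap φA
  obtain ⟨φ0, hφ0⟩ := lift_through (coordMap A L k) (hc k) (φA ∘ₗ Q.subtype) (fun q => q.2)
  have hinjφ : Function.Injective φ0 := by
    intro p q h
    apply Subtype.ext
    apply hinj
    have h3 := hφ0 p
    rw [h, hφ0 q] at h3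
    exact h3.symm
  have hQN : IsNoetherian A Q := isNoetherian_of_injective φ0 hinjφ
  have hQfin : Module.Finite A Q := inferInstance
  have hmem : ∀ {ι : Type} [Finite ι] (p : ι → P), ∃ N : ℕ, ∀ i, x ^ N • p i ∈ Q := by
    intro ι _ p
    obtain ⟨N, hN⟩ := clear_den x (fun i => φ (p i))
    refine ⟨N, fun i => ?_⟩
    obtain ⟨y, hy⟩ := hN i
    refine ⟨y, ?_⟩
    rw [hy, map_smul]
    rfl
  -- the maps through the free modules
  let ψ0 : (Fin k → A) →ₗ[A] Q := (ψA ∘ₗ coordMap A L k).codRestrict Q (fun v => by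
    refine ⟨a • v, ?_⟩
    rw [map_smul]
    exact (h2 _).symm)
  have hψφ : ∀ q, ψ0 (φ0 q) = a • q := by
    intro q
    apply Subtype.ext
    change ψ (coordMap A L k (φ0 q)) = a • (q : P)
    rw [hφ0]
    exact h1 q
  obtain ⟨M, hM⟩ := hmem (fun j : Fin r => π (Pi.single j 1))
  have hMQ : ∀ v : Fin r → A, x ^ M • π (coordMap A L r v) ∈ Q := by
    intro v
    have : x ^ M • π (coordMap A L r v) = ∑ j, v j • (x ^ M • π (Pi.single j 1)) := by
      have h3 : coordMap A L r v = ∑ j, v j • (Pi.single j 1 : Fin r → L) := by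
        funext i
        simp [coordMap_apply, Finset.sum_apply, Pi.single_apply, Algebra.smul_def]
      rw [h3, map_sum, Finset.smul_sum]
      refine Finset.sum_congr rfl fun j _ => ?_
      rw [smul_comm, LinearMap.map_smul_of_tower]
    rw [this]
    exact Q.sum_mem fun j _ => Q.smul_mem _ (hM j)
  let π0 : (Fin r → A) →ₗ[A] Q := (x ^ M • (πA ∘ₗ coordMap A L r)).codRestrict Q hMQ
  obtain ⟨m, g, hg⟩ := Module.Finite.exists_fin (R := A) (M := Q)
  obtain ⟨N, hN⟩ := clear_den x (fun i => s (g i : P))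
  have hNs : ∀ q : Q, ∃ y, coordMap A L r y = (x ^ N • (sA ∘ₗ Q.subtype)) q := by
    have : (⊤ : Submodule A Q) ≤ (LinearMap.range (coordMap A L r)).comap
        (x ^ N • (sA ∘ₗ Q.subtype)) := by
      rw [← hg, Submodule.span_le]
      rintro _ ⟨i, rfl⟩
      exact hN i
    exact fun q => this (Submodule.mem_top (x := q))
  obtain ⟨s0, hs0⟩ := lift_through (coordMap A L r) (hc r) _ hNs
  have hπs : ∀ q, π0 (s0 q) = x ^ (M + N) • q := by
    intro q
    apply Subtype.ext
    change x ^ M • π (coordMap A L r (s0 q)) = x ^ (M + N) • (q : P)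
    rw [hs0]
    change x ^ M • π (x ^ N • s (q : P)) = _
    rw [LinearMap.map_smul_of_tower, hs', smul_smul, pow_add]
  obtain ⟨u, v, huv⟩ := (hax.pow_right (n := M + N))
  have hproj : Module.Projective A Q := by
    refine Module.Projective.of_split (M := (Fin k → A) × (Fin r → A))
      (φ0.prod s0) ((u • ψ0).coprod (v • π0)) ?_
    ext1 q
    change u • ψ0 (φ0 q) + v • π0 (s0 q) = q
    rw [hψφ, hπs]
    rw [smul_smul, smul_smul, ← add_smul, huv, one_smul]
  have hfree : Module.Free A Q := H Q
  have hloc : IsLocalizedModule (Submonoid.powers x) Q.subtype := by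
    refine ⟨?_, ?_, ?_⟩
    · rintro y
      have hu : IsUnit (algebraMap A L y) := IsLocalization.map_units L y
      rw [Module.End.isUnit_iff]
      have h3 := (Module.End.isUnit_iff (R := L) _).1 (hu.map (algebraMap L (Module.End L P)))
      convert h3 using 1
      funext p
      simp [Module.algebraMap_end_apply]
    · intro p
      obtain ⟨N, hN⟩ := hmem (fun _ : Unit => p)
      exact ⟨(⟨_, hN ()⟩, ⟨x ^ N, N, rfl⟩), rfl⟩
    · intro p q h
      exact ⟨1, by rw [Subtype.ext h]⟩
  exact Module.free_of_isLocalizedModule (Submonoid.powers x) Q.subtype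

theorem laurent_loc (R : Type) [CommRing R] : ∃ _ : Algebra (LaurentPolynomial R) (MonicLoc R),
    IsLocalization (((monicSubmonoid R).map (algebraMap R[X] (LaurentPolynomial R))).map
      (LaurentPolynomial.invert (R := R)).toRingEquiv) (MonicLoc R) := by
  have hX : Submonoid.powers (X : R[X]) ≤ monicSubmonoid R := by
    rw [Submonoid.powers_le]
    exact monic_X
  have hu : ∀ y : Submonoid.powers (X : R[X]), IsUnit (algebraMap R[X] (MonicLoc R) y) :=
    fun y => IsLocalization.map_units (MonicLoc R) (⟨y, hX y.2⟩ : monicSubmonoid R)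
  let : Algebra (LaurentPolynomial R) (MonicLoc R) :=
    (IsLocalization.lift (S := LaurentPolynomial R) hu).toAlgebra
  have : IsScalarTower R[X] (LaurentPolynomial R) (MonicLoc R) :=
    IsScalarTower.of_algebraMap_eq fun y => (IsLocalization.lift_eq hu y).symm
  have := IsLocalization.isLocalization_of_submonoid_le (LaurentPolynomial R) (MonicLoc R)
    (Submonoid.powers (X : R[X])) (monicSubmonoid R) hX
  exact ⟨_, IsLocalization.isLocalization_of_base_ringEquiv
    ((monicSubmonoid R).map (algebraMap R[X] (LaurentPolynomial R))) (MonicLoc R)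
    (LaurentPolynomial.invert (R := R)).toRingEquiv⟩

theorem laurent_nzd (R : Type) [CommRing R] :
    ((monicSubmonoid R).map (algebraMap R[X] (LaurentPolynomial R))).map
      (LaurentPolynomial.invert (R := R)).toRingEquiv ≤ nonZeroDivisors (LaurentPolynomial R) := by
  rintro _ ⟨_, ⟨g, hg, rfl⟩, rfl⟩
  have h1 : algebraMap R[X] (LaurentPolynomial R) g ∈ nonZeroDivisors (LaurentPolynomial R) :=
    IsLocalization.map_nonZeroDivisors_le (Submonoid.powers (X : R[X])) (LaurentPolynomial R)
      ⟨g, monicSubmonoid_le R hg, rfl⟩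
  rw [mem_nonZeroDivisors_iff_right]
  intro z hz
  have h2 := congrArg (LaurentPolynomial.invert (R := R)).toRingEquiv.symm hz
  rw [map_mul, map_zero] at h2
  have h3 := (mem_nonZeroDivisors_iff_right.1 h1) _
    (by rw [← h2]; congr 1; exact (RingEquiv.symm_apply_apply _ _).symm)
  exact (map_eq_zero_iff _ (RingEquiv.injective _)).1 h3

theorem i_iii_to_ii (R : Type) [CommRing R] [Nontrivial R] [IsNoetherianRing R]
    (H1 : AllFGProjectiveFree R[X]) (H3 : AllFGProjectiveFree (MonicLoc R)) :
    AllFGProjectiveFree (LaurentPolynomial R) := by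
  intro P _ _ _ _
  have := monicLoc_nontrivial R
  obtain ⟨_, hloc⟩ := laurent_loc R
  obtain ⟨k, φ, ψ, f, hf, h1, h2⟩ := embed_of_loc (B := MonicLoc R) _ (laurent_nzd R) H3 P
  have hfn := laurent_nzd R hf
  obtain ⟨_, ⟨g, hg, rfl⟩, rfl⟩ := hf
  have hg' : g.Monic := hg
  let : Module R[X] P := Module.compHom P (algebraMap R[X] (LaurentPolynomial R))
  have : IsScalarTower R[X] (LaurentPolynomial R) P := IsScalarTower.of_compHom _ _ _
  have hinj : Function.Injective φ := by
    obtain ⟨n, π, hπ⟩ := Module.Finite.exists_fin' (LaurentPolynomial R) P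
    obtain ⟨s, hs⟩ := Module.projective_lifting_property π LinearMap.id hπ
    have hs' : ∀ p, π (s p) = p := fun p => LinearMap.congr_fun hs p
    rw [injective_iff_map_eq_zero]
    intro p hp
    have h3 := h1 p
    rw [hp, map_zero] at h3
    have h4 := congrArg s h3.symm
    rw [map_smul, map_zero] at h4
    have h5 : s p = 0 := by
      funext i
      have h6 := congrFun h4 i
      simp only [Pi.smul_apply, smul_eq_mul, Pi.zero_apply] at h6
      exact (mem_nonZeroDivisors_iff.1 hfn).1 _ h6
    rw [← hs' p, h5, map_zero]
  have hrev : algebraMap R[X] (LaurentPolynomial R) g.reverse =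
      LaurentPolynomial.T g.natDegree * LaurentPolynomial.invert (R := R) (toLaurent g) := by
    rw [mul_comm]
    exact LaurentPolynomial.toLaurent_reverse g
  have hcop : IsCoprime g.reverse X := by
    refine ⟨1, - g.reverse.divX, ?_⟩
    have h3 := Polynomial.divX_mul_X_add g.reverse
    rw [coeff_zero_reverse, hg'.leadingCoeff, map_one] at h3
    linear_combination - h3
  refine core_descent (X : R[X]) monic_X.mem_nonZeroDivisors H1 φ
    ((LaurentPolynomial.T g.natDegree : LaurentPolynomial R) • ψ) g.reverse hcop hinj ?_ ?_
  · intro p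
    rw [LinearMap.smul_apply, h1, smul_smul, ← algebraMap_smul (LaurentPolynomial R) g.reverse, hrev]
    rfl
  · intro v
    rw [LinearMap.smul_apply, map_smul, h2, smul_smul, 
      ← algebraMap_smul (LaurentPolynomial R) g.reverse, hrev]
    rfl

/-- **Theorem 1.** For a commutative regular local ring `R` (a noetherian local ring whose
Krull dimension equals the dimension of its cotangent space `m/m²` over the residue field),
the following are equivalent: all finitely generated projective modules are free over
(i) the polynomial ring `R[t]`, (ii) the Laurent polynomial ring `R[t,t⁻¹]`,
(iii) `R⟨t⟩`, (iv) the formal Laurent series ring `R((t))`. -/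
theorem fgProjectiveFree_tfae_of_regularLocal (R : Type) [CommRing R] [IsLocalRing R]
    [IsNoetherianRing R]
    (hreg : (Module.finrank (IsLocalRing.ResidueField R) (IsLocalRing.CotangentSpace R) :
      WithBot ℕ∞) = ringKrullDim R) :
    List.TFAE
      [AllFGProjectiveFree (Polynomial R),
       AllFGProjectiveFree (LaurentPolynomial R),
       AllFGProjectiveFree (MonicLoc R),
       AllFGProjectiveFree (LaurentSeries R)] := by
  have : IsRegularLocalRing R := (IsRegularLocalRing.iff_finrank_cotangentSpace R).2 hreg
  tfae_have 1 → 4 := i_to_iv R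
  tfae_have 2 → 4 := ii_to_iv R
  tfae_have 4 → 3 := iv_to_iii R
  tfae_have 3 → 1 := iii_to_i R
  tfae_have 1 → 2 := fun h => i_iii_to_ii R h (iv_to_iii R (i_to_iv R h))
  tfae_finish
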